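/- (Intermediate gain of regularity for s > 1/2.) Let n ≥ 1, s ∈ (1/2, 1), β > 0 and let Ω ⊆ ℝⁿ be an open set. Let K satisfy the symmetry, growth and Hölder conditions (i)–(iii). Let f ∈ L²(Ω) and let u ∈ X(Ω) with ‖u‖_{L¹_β(ℝⁿ)} < ∞ be a solution of E_K(u,·) = f in Ω. Then for every open set Ω′ whose closure is compact and contained in Ω, there exists a constant C > 0, depending only on n, s, β, λ, Λ, M, Γ, Ω and Ω′ (and not on u or f), such that sup_{z ∈ ℝⁿ \ {0}} |z|^{−(1/2+s)} ‖Δ_z² u‖_{L²(Ω′_{2z})} ≤ C ( ‖u‖_{L²(Ω)} + ‖u‖_{L¹_β(ℝⁿ)} + ‖f‖_{L²(Ω)} ), i.e. u ∈ N^{1/2+s,2}_loc(Ω). -/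

import Mathlib

open MeasureTheory Set Metric

noncomputable section

abbrev V (n : ℕ) : Type := EuclideanSpace ℝ (Fin n)

variable {n : ℕ}

/-- The cross-shaped set `C_Ω = (ℝⁿ×ℝⁿ) \ ((ℝⁿ\Ω)×(ℝⁿ\Ω))`. -/
def crossSet (Ω : Set (V n)) : Set (V n × V n) := {p | p.1 ∈ Ω ∨ p.2 ∈ Ω}

/-- Membership in the energy space `X(Ω)`. -/
def MemX (Ω : Set (V n)) (K : V n → V n → ℝ) (u : V n → ℝ) : Prop :=
  Measurable u ∧ IntegrableOn (fun x => u x ^ 2) Ω ∧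
    IntegrableOn (fun p : V n × V n => (u p.1 - u p.2) ^ 2 * K p.1 p.2) (crossSet Ω)

/-- Membership in `X₀(Ω)`: member of `X(Ω)` vanishing a.e. outside `Ω`. -/
def MemX0 (Ω : Set (V n)) (K : V n → V n → ℝ) (u : V n → ℝ) : Prop :=
  MemX Ω K u ∧ ∀ᵐ x ∂(volume : Measure (V n)), x ∉ Ω → u x = 0

/-- The bilinear form `E_K(u,φ)`. -/
def energyForm (K : V n → V n → ℝ) (u φ : V n → ℝ) : ℝ :=
  ∫ x, ∫ y, (u x - u y) * (φ x - φ y) * K x y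

/-- `u` is a weak solution of `E_K(u,·) = f` in `Ω`. -/
def IsSolution (Ω : Set (V n)) (K : V n → V n → ℝ) (u f : V n → ℝ) : Prop :=
  ∀ φ : V n → ℝ, MemX0 Ω K φ → energyForm K u φ = ∫ x in Ω, f x * φ x

/-- Symmetry of the kernel. -/
def KSym (K : V n → V n → ℝ) : Prop :=
  ∀ᵐ p ∂(volume : Measure (V n × V n)), K p.1 p.2 = K p.2 p.1

/-- Growth conditions (i) and (ii) on the kernel. -/
def KBounds (s β lam Lam M : ℝ) (K : V n → V n → ℝ) : Prop :=
  (∀ᵐ p ∂(volume : Measure (V n × V n)), ‖p.1 - p.2‖ < 1 →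
      lam ≤ ‖p.1 - p.2‖ ^ ((n : ℝ) + 2 * s) * K p.1 p.2 ∧
        ‖p.1 - p.2‖ ^ ((n : ℝ) + 2 * s) * K p.1 p.2 ≤ Lam) ∧
  ∀ᵐ p ∂(volume : Measure (V n × V n)), 1 ≤ ‖p.1 - p.2‖ →
      0 ≤ ‖p.1 - p.2‖ ^ ((n : ℝ) + β) * K p.1 p.2 ∧
        ‖p.1 - p.2‖ ^ ((n : ℝ) + β) * K p.1 p.2 ≤ M

/-- Hölder condition (iii) on the kernel (local translation regularity). -/
def KHolder (s Gam : ℝ) (K : V n → V n → ℝ) : Prop :=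
  ∀ᵐ q ∂(volume : Measure (V n × V n × V n)),
    ‖q.2.1 - q.2.2‖ < 1 → ‖q.1‖ < 1 →
      ‖q.2.1 - q.2.2‖ ^ ((n : ℝ) + 2 * s) *
          |K (q.2.1 + q.1) (q.2.2 + q.1) - K q.2.1 q.2.2| ≤ Gam * ‖q.1‖ ^ s

/-- The `L²` norm over a set `A`. -/
def L2norm (A : Set (V n)) (u : V n → ℝ) : ℝ := (∫ x in A, u x ^ 2) ^ ((1 : ℝ) / 2)

/-- The weighted norm `‖u‖_{L¹_{x₀,β}(ℝⁿ)}`. -/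
def wnorm (β : ℝ) (x₀ : V n) (u : V n → ℝ) : ℝ :=
  ∫ x, |u x| / (1 + ‖x - x₀‖ ^ ((n : ℝ) + β))

/-- Finiteness of the weighted norm `‖u‖_{L¹_{x₀,β}(ℝⁿ)}`. -/
def HasFiniteWnorm (β : ℝ) (x₀ : V n) (u : V n → ℝ) : Prop :=
  Integrable (fun x => |u x| / (1 + ‖x - x₀‖ ^ ((n : ℝ) + β)))

/-- The second difference `Δ_z² u(x) = u(x+2z) − 2u(x+z) + u(x)`. -/
def diff2 (z : V n) (u : V n → ℝ) (x : V n) : ℝ := u (x + 2 • z) - 2 * u (x + z) + u x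

/-- The set `U_{2z} = {x ∈ U : x+z ∈ U, x+2z ∈ U}`. -/
def shift2 (U : Set (V n)) (z : V n) : Set (V n) := {x ∈ U | x + z ∈ U ∧ x + 2 • z ∈ U}

/-! ### The truncated singular weight -/

/-- The truncated weight `|h|^{-(n+2s)}` on `{|h| < δ}`. -/
def sing (s δ : ℝ) (h : V n) : ℝ := if ‖h‖ < δ then ‖h‖ ^ (-((n : ℝ) + 2 * s)) else 0

/-- The second moment of the truncated singular weight. -/
def singMoment (n : ℕ) (s δ : ℝ) : ℝ := ∫ h : V n, ‖h‖ ^ 2 * sing s δ h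

lemma sing_nonneg (s δ : ℝ) (h : V n) : 0 ≤ sing s δ h := by
  unfold sing; split_ifs <;> positivity

lemma sing_neg (s δ : ℝ) (h : V n) : sing s δ (-h) = sing s δ h := by
  simp [sing]

lemma sing_sub_comm (s δ : ℝ) (x y : V n) : sing s δ (x - y) = sing s δ (y - x) := by
  rw [← sing_neg, neg_sub]

lemma measurable_sing (s δ : ℝ) : Measurable (sing s δ : V n → ℝ) := by
  unfold sing
  exact Measurable.ite (measurableSet_lt measurable_norm measurable_const)
    (measurable_norm.pow_const _) measurable_const

lemma measurable_sing_sub (s δ : ℝ) :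
    Measurable (fun p : V n × V n => sing s δ (p.1 - p.2)) :=
  (measurable_sing s δ).comp (measurable_fst.sub measurable_snd)

lemma singMoment_nonneg (n : ℕ) (s δ : ℝ) : 0 ≤ singMoment n s δ :=
  integral_nonneg fun h => mul_nonneg (by positivity) (sing_nonneg s δ h)

lemma integrable_singMoment (hn : 1 ≤ n) {s : ℝ} (hs : s < 1) (δ : ℝ) :
    Integrable (fun h : V n => ‖h‖ ^ 2 * sing s δ h) := by
  have hfin : Module.finrank ℝ (V n) = n := by simp
  have key : IntegrableOn (fun h : V n => ‖h‖ ^ 2 * sing s δ h) (ball 0 δ) := by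
    refine integrableOn_ball_of_norm_le_rpow (C := 1) (α := (n : ℝ) + 2 * s - 2) ?_ ?_ ?_ ?_
    · rw [hfin]; exact hn
    · rw [hfin]; linarith
    · refine ae_restrict_of_forall_mem measurableSet_ball fun h hh => ?_
      have hh' : ‖h‖ < δ := by simpa using hh
      rw [Real.norm_of_nonneg (mul_nonneg (by positivity) (sing_nonneg s δ h)), sing, if_pos hh',
        one_mul]
      rcases eq_or_ne h 0 with rfl | h0
      · simp only [norm_zero, ne_eq, OfNat.ofNat_ne_zero, not_false_eq_true, zero_pow, zero_mul]
        positivity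
      · rw [← Real.rpow_natCast, ← Real.rpow_add (norm_pos_iff.2 h0)]
        apply le_of_eq
        congr 1
        push_cast
        ring
    · exact ((measurable_norm.pow_const 2).mul (measurable_sing s δ)).aestronglyMeasurable
  refine (integrableOn_iff_integrable_of_support_subset ?_).1 key
  intro h hh
  by_contra hb
  apply hh
  have : ¬ ‖h‖ < δ := by simpa using hb
  simp [sing, this]

lemma integrable_prod_sub {a b : V n → ℝ} (ha : Integrable a) (hb : Integrable b) :
    Integrable (fun p : V n × V n => a p.2 * b (p.1 - p.2)) :=
  (measurePreserving_prod_sub_swap (volume : Measure (V n)) volume).integrable_comp_of_integrable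
    (ha.mul_prod hb)

lemma integral_prod_sub {a b : V n → ℝ} (ha : Integrable a) (hb : Integrable b) :
    ∫ p : V n × V n, a p.2 * b (p.1 - p.2) = (∫ x, a x) * ∫ h, b h := by
  have hmp := measurePreserving_prod_sub_swap (volume : Measure (V n)) volume
  have h := integral_map (f := fun q : V n × V n => a q.1 * b q.2) hmp.measurable.aemeasurable
    (by rw [hmp.map_eq]; exact (ha.mul_prod hb).aestronglyMeasurable)
  rw [hmp.map_eq] at h
  rw [Measure.volume_eq_prod, ← h, integral_prod_mul]

lemma integrable_swap {F : V n × V n → ℝ} (hF : Integrable F) :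
    Integrable (fun p : V n × V n => F (p.2, p.1)) := by
  rw [Measure.volume_eq_prod] at *
  exact hF.swap

lemma integral_swap (F : V n × V n → ℝ) :
    ∫ p : V n × V n, F (p.2, p.1) = ∫ p, F p := by
  rw [Measure.volume_eq_prod]
  exact integral_prod_swap F

/-! ### Truncated Gagliardo energies -/

/-- The integrand of the truncated Gagliardo energy. -/
def gagInt (s δ : ℝ) (w : V n → ℝ) (p : V n × V n) : ℝ :=
  (w p.1 - w p.2) ^ 2 * sing s δ (p.1 - p.2)

/-- The truncated Gagliardo energy. -/
def gag (s δ : ℝ) (w : V n → ℝ) : ℝ := ∫ p, gagInt s δ w p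

/-- The squared `L²` norm on the whole space. -/
def sqn (w : V n → ℝ) : ℝ := ∫ x, w x ^ 2

/-- Functions in `L²` with finite truncated Gagliardo energy. -/
structure MemH (s δ : ℝ) (w : V n → ℝ) : Prop where
  meas : Measurable w
  sq : Integrable (fun x => w x ^ 2)
  energy : Integrable (gagInt s δ w)

lemma gagInt_nonneg (s δ : ℝ) (w : V n → ℝ) (p : V n × V n) : 0 ≤ gagInt s δ w p :=
  mul_nonneg (sq_nonneg _) (sing_nonneg _ _ _)

lemma gag_nonneg (s δ : ℝ) (w : V n → ℝ) : 0 ≤ gag s δ w :=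
  integral_nonneg (gagInt_nonneg s δ w)

lemma sqn_nonneg (w : V n → ℝ) : 0 ≤ sqn w := integral_nonneg fun _ => sq_nonneg _

lemma measurable_gagInt {w : V n → ℝ} (hw : Measurable w) (s δ : ℝ) :
    Measurable (gagInt s δ w) :=
  (((hw.comp measurable_fst).sub (hw.comp measurable_snd)).pow_const 2).mul
    (measurable_sing_sub s δ)

instance : (volume : Measure (V n × V n)).IsAddRightInvariant :=
  inferInstanceAs ((volume : Measure (V n)).prod (volume : Measure (V n))).IsAddRightInvariant

lemma gagInt_shift (s δ : ℝ) (w : V n → ℝ) (z : V n) :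
    gagInt s δ (fun x => w (x + z)) = fun p => gagInt s δ w (p + (z, z)) := by
  funext p; simp [gagInt]

lemma MemH.shift {s δ : ℝ} {w : V n → ℝ} (hw : MemH s δ w) (z : V n) :
    MemH s δ (fun x => w (x + z)) where
  meas := hw.meas.comp (measurable_id.add_const z)
  sq := hw.sq.comp_add_right z
  energy := by
    rw [gagInt_shift]
    exact hw.energy.comp_add_right (z, z)

lemma gag_shift (s δ : ℝ) (w : V n → ℝ) (z : V n) :
    gag s δ (fun x => w (x + z)) = gag s δ w := by
  rw [gag, gagInt_shift]
  exact integral_add_right_eq_self (gagInt s δ w) (z, z)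

lemma MemH.sub {s δ : ℝ} {v w : V n → ℝ} (hv : MemH s δ v) (hw : MemH s δ w) :
    MemH s δ (fun x => v x - w x) where
  meas := hv.meas.sub hw.meas
  sq := by
    refine ((hv.sq.const_mul 2).add (hw.sq.const_mul 2)).mono'
      ((hv.meas.sub hw.meas).pow_const 2).aestronglyMeasurable (.of_forall fun x => ?_)
    rw [Real.norm_of_nonneg (sq_nonneg _)]
    simp only [Pi.add_apply]
    nlinarith [sq_nonneg (v x + w x)]
  energy := by
    refine ((hv.energy.const_mul 2).add (hw.energy.const_mul 2)).mono'
      (measurable_gagInt (hv.meas.sub hw.meas) s δ).aestronglyMeasurable (.of_forall fun p => ?_)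
    rw [Real.norm_of_nonneg (gagInt_nonneg _ _ _ _)]
    simp only [Pi.add_apply, gagInt]
    rw [← mul_assoc, ← mul_assoc, ← add_mul]
    refine mul_le_mul_of_nonneg_right ?_ (sing_nonneg _ _ _)
    nlinarith [sq_nonneg (v p.1 - v p.2 + (w p.1 - w p.2))]

/-- A measurable Lipschitz cutoff function with values in `[0,1]`. -/
structure IsCutoff (L : ℝ) (η : V n → ℝ) : Prop where
  meas : Measurable η
  nonneg : ∀ x, 0 ≤ η x
  le_one : ∀ x, η x ≤ 1
  lip : ∀ x y, |η x - η y| ≤ L * ‖x - y‖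

lemma IsCutoff.sq_sub_le {L : ℝ} {η : V n → ℝ} (h : IsCutoff L η) (x y : V n) :
    (η x - η y) ^ 2 ≤ L ^ 2 * ‖x - y‖ ^ 2 := by
  rw [← sq_abs, ← mul_pow]
  exact pow_le_pow_left₀ (abs_nonneg _) (h.lip x y) 2

lemma IsCutoff.sq_le_one {L : ℝ} {η : V n → ℝ} (h : IsCutoff L η) (x : V n) : η x ^ 2 ≤ 1 :=
  pow_le_one₀ (h.nonneg x) (h.le_one x)

lemma IsCutoff.mul_sq_le {L : ℝ} {η : V n → ℝ} (h : IsCutoff L η) (w : V n → ℝ) (x : V n) :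
    (η x * w x) ^ 2 ≤ w x ^ 2 := by
  rw [mul_pow]
  exact mul_le_of_le_one_left (sq_nonneg _) (h.sq_le_one x)

lemma IsCutoff.integrable_sq {L : ℝ} {η : V n → ℝ} (h : IsCutoff L η) {w : V n → ℝ}
    (hm : Measurable w) (hw : Integrable (fun x => w x ^ 2)) :
    Integrable (fun x => (η x * w x) ^ 2) := by
  refine hw.mono' ((h.meas.mul hm).pow_const 2).aestronglyMeasurable (.of_forall fun x => ?_)
  rw [Real.norm_of_nonneg (sq_nonneg _)]
  exact h.mul_sq_le w x

lemma IsCutoff.sqn_mul_le {L : ℝ} {η : V n → ℝ} (h : IsCutoff L η) {w : V n → ℝ}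
    (hm : Measurable w) (hw : Integrable (fun x => w x ^ 2)) :
    sqn (fun x => η x * w x) ≤ sqn w :=
  integral_mono (h.integrable_sq hm hw) hw fun x => h.mul_sq_le w x

lemma gagInt_mul_le {L : ℝ} {η : V n → ℝ} (h : IsCutoff L η) (s δ : ℝ) (w : V n → ℝ)
    (p : V n × V n) :
    gagInt s δ (fun x => η x * w x) p ≤ 2 * (η p.1 ^ 2 * gagInt s δ w p) +
      2 * L ^ 2 * (w p.2 ^ 2 * (‖p.1 - p.2‖ ^ 2 * sing s δ (p.1 - p.2))) := by
  have h1 : (η p.1 * w p.1 - η p.2 * w p.2) ^ 2 ≤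
      2 * (η p.1 ^ 2 * (w p.1 - w p.2) ^ 2) + 2 * L ^ 2 * (w p.2 ^ 2 * ‖p.1 - p.2‖ ^ 2) := by
    have := mul_le_mul_of_nonneg_left (h.sq_sub_le p.1 p.2) (sq_nonneg (w p.2))
    nlinarith [sq_nonneg (η p.1 * (w p.1 - w p.2) - (η p.1 - η p.2) * w p.2)]
  have := mul_le_mul_of_nonneg_right h1 (sing_nonneg s δ (p.1 - p.2))
  simp only [gagInt]
  linarith

lemma integrable_moment (hn : 1 ≤ n) {s : ℝ} (hs : s < 1) (δ : ℝ) {a : V n → ℝ}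
    (ha : Integrable a) :
    Integrable (fun p : V n × V n => a p.2 * (‖p.1 - p.2‖ ^ 2 * sing s δ (p.1 - p.2))) :=
  integrable_prod_sub ha (integrable_singMoment hn hs δ)

lemma integral_moment (hn : 1 ≤ n) {s : ℝ} (hs : s < 1) (δ : ℝ) {a : V n → ℝ}
    (ha : Integrable a) :
    ∫ p : V n × V n, a p.2 * (‖p.1 - p.2‖ ^ 2 * sing s δ (p.1 - p.2)) =
      (∫ x, a x) * singMoment n s δ :=
  integral_prod_sub ha (integrable_singMoment hn hs δ)

lemma MemH.cutoff_mul (hn : 1 ≤ n) {s δ L : ℝ} (hs : s < 1) {η w : V n → ℝ} (h : IsCutoff L η)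
    (hw : MemH s δ w) : MemH s δ (fun x => η x * w x) where
  meas := h.meas.mul hw.meas
  sq := h.integrable_sq hw.meas hw.sq
  energy := by
    refine ((hw.energy.const_mul 2).add
      ((integrable_moment hn hs δ hw.sq).const_mul (2 * L ^ 2))).mono'
      (measurable_gagInt (h.meas.mul hw.meas) s δ).aestronglyMeasurable (.of_forall fun p => ?_)
    rw [Real.norm_of_nonneg (gagInt_nonneg _ _ _ _)]
    refine (gagInt_mul_le h s δ w p).trans ?_
    simp only [Pi.add_apply]
    gcongr
    exact mul_le_of_le_one_left (gagInt_nonneg _ _ _ _) (h.sq_le_one _)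

lemma gag_cutoff_mul_le (hn : 1 ≤ n) {s δ L : ℝ} (hs : s < 1) {η w : V n → ℝ} (h : IsCutoff L η)
    (hw : MemH s δ w) :
    gag s δ (fun x => η x * w x) ≤ 2 * gag s δ w + 2 * L ^ 2 * singMoment n s δ * sqn w := by
  have hi := (integrable_moment hn hs δ hw.sq).const_mul (2 * L ^ 2)
  have hint := (hw.energy.const_mul 2).add hi
  calc gag s δ (fun x => η x * w x) ≤ _ :=
        integral_mono (hw.cutoff_mul hn hs h).energy hint fun p => by
          refine (gagInt_mul_le h s δ w p).trans ?_
          simp only [Pi.add_apply]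
          gcongr
          exact mul_le_of_le_one_left (gagInt_nonneg _ _ _ _) (h.sq_le_one _)
    _ = _ := by
        simp only [Pi.add_apply]
        rw [integral_add (hw.energy.const_mul 2) hi, integral_const_mul, integral_const_mul,
          integral_moment hn hs δ hw.sq]
        simp only [gag, sqn]
        ring

/-! ### Translation estimate -/

lemma sq_sub_le_gagInt (hn : 1 ≤ n) {s δ r : ℝ} (hs : 0 < s) (hr : r < δ) (w : V n → ℝ)
    {p : V n × V n} (hp : ‖p.1 - p.2‖ < r) :
    (w p.1 - w p.2) ^ 2 ≤ r ^ ((n : ℝ) + 2 * s) * gagInt s δ w p := by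
  have hr0 : 0 < r := (norm_nonneg _).trans_lt hp
  rcases eq_or_ne p.1 p.2 with h | h
  · simp only [h, sub_self, ne_eq, OfNat.ofNat_ne_zero, not_false_eq_true, zero_pow]
    exact mul_nonneg (by positivity) (gagInt_nonneg _ _ _ _)
  · have hpos : 0 < ‖p.1 - p.2‖ := norm_pos_iff.2 (sub_ne_zero.2 h)
    have h1 : 1 ≤ r ^ ((n : ℝ) + 2 * s) * sing s δ (p.1 - p.2) := by
      rw [sing, if_pos (hp.trans hr), Real.rpow_neg hpos.le, ← div_eq_mul_inv,
        one_le_div (by positivity)]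
      exact Real.rpow_le_rpow hpos.le hp.le (by positivity)
    calc (w p.1 - w p.2) ^ 2 ≤
        (w p.1 - w p.2) ^ 2 * (r ^ ((n : ℝ) + 2 * s) * sing s δ (p.1 - p.2)) :=
          le_mul_of_one_le_right (sq_nonneg _) h1
      _ = _ := by rw [gagInt]; ring

/-- The constant in the translation estimate. -/
def transConst (n : ℕ) : ℝ := 4 * 2 ^ n / volume.real (ball (0 : V n) 1)

lemma volume_real_unitBall_pos (n : ℕ) : 0 < volume.real (ball (0 : V n) 1) :=
  ENNReal.toReal_pos (measure_ball_pos _ _ one_pos).ne' measure_ball_lt_top.ne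

lemma transConst_pos (n : ℕ) : 0 < transConst n :=
  div_pos (by positivity) (volume_real_unitBall_pos n)

lemma sqn_translate_le (hn : 1 ≤ n) {s δ : ℝ} (hs : 0 < s) {w : V n → ℝ} (hw : MemH s δ w)
    {z : V n} (hz : z ≠ 0) (hzδ : ‖z‖ < δ) :
    sqn (fun x => w (x + z) - w x) ≤ transConst n * ‖z‖ ^ (2 * s) * gag s δ w := by
  have hz0 : 0 < ‖z‖ := norm_pos_iff.2 hz
  have ha := ((hw.shift z).sub hw).sq
  set c : V n := (2⁻¹ : ℝ) • z with hc
  have hcn : ‖c‖ = ‖z‖ / 2 := by rw [hc, norm_smul]; norm_num; ring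
  set B : Set (V n) := ball c (‖z‖ / 2) with hB
  set b : V n → ℝ := B.indicator (fun _ => (1 : ℝ)) with hb
  have hbi : Integrable b :=
    (integrable_indicator_iff measurableSet_ball).2 (integrableOn_const measure_ball_lt_top.ne)
  have hbint : ∫ h, b h = (‖z‖ / 2) ^ n * volume.real (ball (0 : V n) 1) := by
    rw [hb, integral_indicator measurableSet_ball, setIntegral_const, smul_eq_mul, mul_one]
    rw [measureReal_def, Measure.addHaar_ball_of_pos _ _ (half_pos hz0), ENNReal.toReal_mul,
      ENNReal.toReal_ofReal (by positivity), finrank_euclideanSpace_fin, ← measureReal_def]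
  have hQ := hw.energy
  have hQ' : Integrable (fun p => gagInt s δ w (p + (0, z))) := hQ.comp_add_right (0, z)
  have hQi : ∫ p, gagInt s δ w (p + (0, z)) = gag s δ w :=
    integral_add_right_eq_self (gagInt s δ w) (0, z)
  have hmain := integral_mono (integrable_prod_sub ha hbi)
    ((hQ.add hQ').const_mul (2 * ‖z‖ ^ ((n : ℝ) + 2 * s))) (fun p => by
      simp only [Pi.add_apply]
      by_cases hp : p.1 - p.2 ∈ B
      · have hpb : ‖p.1 - p.2 - c‖ < ‖z‖ / 2 := by
          rw [hB, mem_ball, dist_eq_norm] at hp; exact hp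
        have h1 : ‖p.1 - p.2‖ < ‖z‖ := by
          calc ‖p.1 - p.2‖ = ‖(p.1 - p.2 - c) + c‖ := by rw [sub_add_cancel]
            _ ≤ ‖p.1 - p.2 - c‖ + ‖c‖ := norm_add_le _ _
            _ < ‖z‖ := by rw [hcn]; linarith
        have hzc : z = c + c := by
          rw [hc, ← add_smul]; norm_num
        have h2 : ‖p.1 - (p.2 + z)‖ < ‖z‖ := by
          calc ‖p.1 - (p.2 + z)‖ = ‖(p.1 - p.2 - c) - c‖ := by
                congr 1; conv_lhs => rw [hzc]
                abel
            _ ≤ ‖p.1 - p.2 - c‖ + ‖c‖ := norm_sub_le _ _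
            _ < ‖z‖ := by rw [hcn]; linarith
        have e1 := sq_sub_le_gagInt hn hs hzδ w h1
        have e2 := sq_sub_le_gagInt hn hs hzδ w (p := p + (0, z)) (by simpa using h2)
        simp only [Prod.fst_add, Prod.snd_add, add_zero] at e2
        have hb1 : b (p.1 - p.2) = 1 := by simp [hb, hp]
        rw [hb1, mul_one]
        nlinarith [sq_nonneg ((w (p.2 + z) - w p.1) - (w p.1 - w p.2))]
      · have hb0 : b (p.1 - p.2) = 0 := by simp [hb, hp]
        rw [hb0, mul_zero]
        have := gagInt_nonneg s δ w p
        have := gagInt_nonneg s δ w (p + (0, z))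
        positivity)
  rw [integral_prod_sub ha hbi, hbint, integral_const_mul] at hmain
  simp only [Pi.add_apply] at hmain
  rw [integral_add hQ hQ', hQi] at hmain
  have hv := volume_real_unitBall_pos n
  have hfin : sqn (fun x => w (x + z) - w x) * (‖z‖ ^ n / 2 ^ n * volume.real (ball (0 : V n) 1)) ≤
      2 * (‖z‖ ^ n * ‖z‖ ^ (2 * s)) * (gag s δ w + gag s δ w) := by
    rw [← div_pow]
    rw [Real.rpow_add hz0, Real.rpow_natCast] at hmain
    exact hmain
  have hpos : 0 < ‖z‖ ^ n / 2 ^ n * volume.real (ball (0 : V n) 1) := by positivity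
  refine le_of_mul_le_mul_right (hfin.trans (le_of_eq ?_)) hpos
  rw [transConst]
  field_simp
  ring

/-! ### Bilinear forms with kernels comparable to the truncated singular weight -/

/-- The bilinear form with kernel `κ`. -/
def form (κ : V n × V n → ℝ) (w ψ : V n → ℝ) : ℝ :=
  ∫ p, κ p * ((w p.1 - w p.2) * (ψ p.1 - ψ p.2))

lemma abs_form_integrand_le {κ : V n × V n → ℝ} {B s δ : ℝ} {p : V n × V n}
    (hp : |κ p| ≤ B * sing s δ (p.1 - p.2)) (w ψ : V n → ℝ) {t : ℝ} (ht : 0 < t) :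
    |κ p * ((w p.1 - w p.2) * (ψ p.1 - ψ p.2))| ≤
      B * (t⁻¹ * gagInt s δ w p + t * gagInt s δ ψ p) := by
  set a := w p.1 - w p.2 with ha
  set b := ψ p.1 - ψ p.2 with hb
  have h1 : |a * b| ≤ t⁻¹ * a ^ 2 + t * b ^ 2 := by
    have h3 : t⁻¹ * (a - t * b) ^ 2 = t⁻¹ * a ^ 2 + t * b ^ 2 - 2 * (a * b) := by
      field_simp; ring
    have h4 : t⁻¹ * (a + t * b) ^ 2 = t⁻¹ * a ^ 2 + t * b ^ 2 + 2 * (a * b) := by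
      field_simp; ring
    have h5 : 0 ≤ t⁻¹ * (a - t * b) ^ 2 := by positivity
    have h6 : 0 ≤ t⁻¹ * (a + t * b) ^ 2 := by positivity
    rw [abs_le]; constructor <;> nlinarith [mul_nonneg (inv_nonneg.2 ht.le) (sq_nonneg a),
      mul_nonneg ht.le (sq_nonneg b)]
  rw [abs_mul]
  calc |κ p| * |a * b| ≤ (B * sing s δ (p.1 - p.2)) * (t⁻¹ * a ^ 2 + t * b ^ 2) :=
        mul_le_mul hp h1 (abs_nonneg _) ((abs_nonneg _).trans hp)
    _ = _ := by simp only [gagInt, ← ha, ← hb]; ring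

lemma measurable_diff_mul {w ψ : V n → ℝ} (hw : Measurable w) (hψ : Measurable ψ) :
    Measurable (fun p : V n × V n => (w p.1 - w p.2) * (ψ p.1 - ψ p.2)) :=
  ((hw.comp measurable_fst).sub (hw.comp measurable_snd)).mul
    ((hψ.comp measurable_fst).sub (hψ.comp measurable_snd))

lemma integrable_form {κ : V n × V n → ℝ} {B s δ : ℝ} (hκm : Measurable κ)
    (hκ : ∀ᵐ p, |κ p| ≤ B * sing s δ (p.1 - p.2)) {w ψ : V n → ℝ} (hw : MemH s δ w)
    (hψ : MemH s δ ψ) :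
    Integrable (fun p => κ p * ((w p.1 - w p.2) * (ψ p.1 - ψ p.2))) := by
  refine (((hw.energy.const_mul (1 : ℝ)⁻¹).add (hψ.energy.const_mul 1)).const_mul B).mono'
    (hκm.mul (measurable_diff_mul hw.meas hψ.meas)).aestronglyMeasurable ?_
  filter_upwards [hκ] with p hp
  exact abs_form_integrand_le hp w ψ one_pos

lemma abs_form_le {κ : V n × V n → ℝ} {B s δ : ℝ} (hκm : Measurable κ)
    (hκ : ∀ᵐ p, |κ p| ≤ B * sing s δ (p.1 - p.2)) {w ψ : V n → ℝ} (hw : MemH s δ w)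
    (hψ : MemH s δ ψ) {t : ℝ} (ht : 0 < t) :
    |form κ w ψ| ≤ B * (t⁻¹ * gag s δ w + t * gag s δ ψ) := by
  have hi := ((hw.energy.const_mul t⁻¹).add (hψ.energy.const_mul t)).const_mul B
  calc |form κ w ψ| ≤ ∫ p, |κ p * ((w p.1 - w p.2) * (ψ p.1 - ψ p.2))| :=
        abs_integral_le_integral_abs
    _ ≤ _ := integral_mono_ae (integrable_form hκm hκ hw hψ).abs hi (by
        filter_upwards [hκ] with p hp
        exact abs_form_integrand_le hp w ψ ht)
    _ = _ := by
        rw [integral_const_mul]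
        simp only [Pi.add_apply]
        rw [integral_add (hw.energy.const_mul _) (hψ.energy.const_mul _), integral_const_mul,
          integral_const_mul]
        rfl

/-- A nonnegative kernel comparable to the truncated singular weight. -/
structure IsNearKernel (s δ lam Lam : ℝ) (κ : V n × V n → ℝ) : Prop where
  meas : Measurable κ
  lower : ∀ᵐ p, lam * sing s δ (p.1 - p.2) ≤ κ p
  upper : ∀ᵐ p, κ p ≤ Lam * sing s δ (p.1 - p.2)

lemma IsNearKernel.abs_le {s δ lam Lam : ℝ} {κ : V n × V n → ℝ} (hκ : IsNearKernel s δ lam Lam κ)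
    (hlam : 0 ≤ lam) : ∀ᵐ p, |κ p| ≤ Lam * sing s δ (p.1 - p.2) := by
  filter_upwards [hκ.lower, hκ.upper] with p h1 h2
  rwa [abs_of_nonneg ((mul_nonneg hlam (sing_nonneg _ _ _)).trans h1)]

/-- The Caccioppoli inequality. -/
lemma caccioppoli (hn : 1 ≤ n) {s δ lam Lam L : ℝ} (hs : s < 1) (hlam : 0 ≤ lam)
    {κ : V n × V n → ℝ} (hκ : IsNearKernel s δ lam Lam κ) {η w : V n → ℝ} (h : IsCutoff L η)
    (hw : MemH s δ w) :
    lam * gag s δ (fun x => η x * w x) ≤ form κ w (fun x => η x * (η x * w x)) +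
      Lam * L ^ 2 * singMoment n s δ * sqn w := by
  have hηw := hw.cutoff_mul hn hs h
  have hψ := hηw.cutoff_mul hn hs h
  have hI := integrable_form hκ.meas (hκ.abs_le hlam) hw hψ
  have hm := integrable_moment hn hs δ hw.sq
  have hm' := integrable_swap hm
  have hM := (hm.add hm').const_mul (Lam * L ^ 2 / 2)
  calc lam * gag s δ (fun x => η x * w x)
      = ∫ p, lam * gagInt s δ (fun x => η x * w x) p := by rw [gag, integral_const_mul]
    _ ≤ _ := integral_mono_ae (hηw.energy.const_mul lam) (hI.add hM) (by
        filter_upwards [hκ.lower, hκ.upper] with p h1 h2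
        simp only [Pi.add_apply]
        have hk0 : 0 ≤ κ p := (mul_nonneg hlam (sing_nonneg _ _ _)).trans h1
        have e1 : lam * gagInt s δ (fun x => η x * w x) p ≤
            κ p * (η p.1 * w p.1 - η p.2 * w p.2) ^ 2 := by
          rw [gagInt]
          nlinarith [mul_le_mul_of_nonneg_right h1
            (sq_nonneg (η p.1 * w p.1 - η p.2 * w p.2))]
        have e2 : w p.1 * w p.2 * (η p.1 - η p.2) ^ 2 ≤
            (w p.1 ^ 2 + w p.2 ^ 2) / 2 * (L ^ 2 * ‖p.1 - p.2‖ ^ 2) := by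
          have e5 : w p.1 * w p.2 ≤ (w p.1 ^ 2 + w p.2 ^ 2) / 2 := by
            nlinarith [sq_nonneg (w p.1 - w p.2)]
          exact (mul_le_mul_of_nonneg_right e5 (sq_nonneg _)).trans
            (mul_le_mul_of_nonneg_left (h.sq_sub_le p.1 p.2) (by positivity))
        have e3 := mul_le_mul_of_nonneg_left e2 hk0
        have e4 : κ p * ((w p.1 ^ 2 + w p.2 ^ 2) / 2 * (L ^ 2 * ‖p.1 - p.2‖ ^ 2)) ≤
            Lam * sing s δ (p.1 - p.2) *
              ((w p.1 ^ 2 + w p.2 ^ 2) / 2 * (L ^ 2 * ‖p.1 - p.2‖ ^ 2)) :=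
          mul_le_mul_of_nonneg_right h2 (by positivity)
        rw [norm_sub_rev p.2 p.1, sing_sub_comm s δ p.2 p.1]
        nlinarith)
    _ = _ := by
        rw [integral_add' hI hM, integral_const_mul, integral_add' hm hm',
          integral_swap (fun p : V n × V n => w p.2 ^ 2 * (‖p.1 - p.2‖ ^ 2 * sing s δ (p.1 - p.2))),
          integral_moment hn hs δ hw.sq]
        simp only [form, sqn]
        ring

lemma form_sub_right {κ : V n × V n → ℝ} {B s δ : ℝ} (hκm : Measurable κ)
    (hκ : ∀ᵐ p, |κ p| ≤ B * sing s δ (p.1 - p.2)) {w ψ₁ ψ₂ : V n → ℝ} (hw : MemH s δ w)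
    (h₁ : MemH s δ ψ₁) (h₂ : MemH s δ ψ₂) :
    form κ w (fun x => ψ₁ x - ψ₂ x) = form κ w ψ₁ - form κ w ψ₂ := by
  rw [form, form, form, ← integral_sub (integrable_form hκm hκ hw h₁)
    (integrable_form hκm hκ hw h₂)]
  congr 1
  funext p
  ring

lemma form_sub_left {κ : V n × V n → ℝ} {B s δ : ℝ} (hκm : Measurable κ)
    (hκ : ∀ᵐ p, |κ p| ≤ B * sing s δ (p.1 - p.2)) {w₁ w₂ ψ : V n → ℝ} (h₁ : MemH s δ w₁)
    (h₂ : MemH s δ w₂) (hψ : MemH s δ ψ) :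
    form κ (fun x => w₁ x - w₂ x) ψ = form κ w₁ ψ - form κ w₂ ψ := by
  rw [form, form, form, ← integral_sub (integrable_form hκm hκ h₁ hψ)
    (integrable_form hκm hκ h₂ hψ)]
  congr 1
  funext p
  ring

lemma form_sub_kernel {κ₁ κ₂ : V n × V n → ℝ} {B₁ B₂ s δ : ℝ} (hκm₁ : Measurable κ₁)
    (hκ₁ : ∀ᵐ p, |κ₁ p| ≤ B₁ * sing s δ (p.1 - p.2)) (hκm₂ : Measurable κ₂)
    (hκ₂ : ∀ᵐ p, |κ₂ p| ≤ B₂ * sing s δ (p.1 - p.2)) {w ψ : V n → ℝ} (hw : MemH s δ w)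
    (hψ : MemH s δ ψ) :
    form (fun p => κ₁ p - κ₂ p) w ψ = form κ₁ w ψ - form κ₂ w ψ := by
  rw [form, form, form, ← integral_sub (integrable_form hκm₁ hκ₁ hw hψ)
    (integrable_form hκm₂ hκ₂ hw hψ)]
  congr 1
  funext p
  ring

lemma form_shift (κ : V n × V n → ℝ) (w ψ : V n → ℝ) (z : V n) :
    form κ w (fun x => ψ (x - z)) = form (fun p => κ (p + (z, z))) (fun x => w (x + z)) ψ := by
  rw [form, ← integral_add_right_eq_self _ (z, z)]
  simp [form]

lemma ae_shift {P : V n × V n → Prop} (h : ∀ᵐ p, P p) (z : V n × V n) : ∀ᵐ p, P (p + z) :=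
  (measurePreserving_add_right (volume : Measure (V n × V n)) z).quasiMeasurePreserving.ae h

/-- Discrete differentiation of the equation. If `v` solves a nonlocal equation with right-hand
side controlled by `R` in `L²`, then localised first differences of `v` have a truncated Gagliardo
energy of order `‖z‖ ^ (2 * s)`, and second differences are of order `‖z‖ ^ (2 * s)` in `L²`. -/
lemma exists_second_difference_bound (hn : 1 ≤ n) {s : ℝ} (hs0 : 0 < s) (hs : s < 1)
    {lam Lam G C₁ : ℝ} (δ L : ℝ) (hlam : 0 < lam) (hLam : 0 ≤ Lam) (hG : 0 < G) (hC₁ : 0 < C₁) :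
    ∃ C > 0, ∀ (κ : V n × V n → ℝ) (η v : V n → ℝ) (z : V n) (R : ℝ), 0 ≤ R → z ≠ 0 → ‖z‖ < δ →
      IsNearKernel s δ lam Lam κ →
      (∀ᵐ p, |κ (p + (z, z)) - κ p| ≤ G * ‖z‖ ^ s * sing s δ (p.1 - p.2)) →
      IsCutoff L η → MemH s δ v →
      (∀ ψ : V n → ℝ, (ψ = fun x => η x * (η x * (v (x + z) - v x))) → ∀ t > 0,
        form κ v (fun x => ψ (x - z) - ψ x) ≤
          t⁻¹ * R + t * C₁ * sqn (fun x => ψ (x - z) - ψ x)) →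
      sqn (fun x => η (x + z) * (v (x + z + z) - v (x + z)) - η x * (v (x + z) - v x)) ≤
        C * (‖z‖ ^ (2 * s)) ^ 2 * (R + gag s δ v) := by
  set T := transConst n with hT
  have hT0 : 0 < T := transConst_pos n
  set m := singMoment n s δ with hm
  have hm0 : 0 ≤ m := singMoment_nonneg n s δ
  set τ : ℝ := lam / (4 * (C₁ * T + G)) with hτ
  have hCG : 0 < C₁ * T + G := by positivity
  have hτ0 : 0 < τ := by positivity
  have hτeq : τ * (C₁ * T + G) = lam / 4 := by rw [hτ]; field_simp
  set C₂ : ℝ := τ⁻¹ + G * τ⁻¹ + Lam * L ^ 2 * m * T + lam / 2 * L ^ 2 * m * T with hC₂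
  refine ⟨T * (2 / lam * C₂), by positivity, ?_⟩
  intro κ η v z R hR hz hzδ hκ hhol hη hv heq
  have hz0 : 0 < ‖z‖ := norm_pos_iff.2 hz
  set ρ : ℝ := ‖z‖ ^ (2 * s) with hρ
  have hρ0 : 0 < ρ := Real.rpow_pos_of_pos hz0 _
  have hρs : ‖z‖ ^ s * ‖z‖ ^ s = ρ := by rw [hρ, ← Real.rpow_add hz0]; congr 1; ring
  have hzs : 0 < ‖z‖ ^ s := Real.rpow_pos_of_pos hz0 _
  have hvz := hv.shift z
  have hD : MemH s δ (fun x => v (x + z) - v x) := hvz.sub hv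
  have hηD := hD.cutoff_mul hn hs hη
  set D : V n → ℝ := fun x => v (x + z) - v x with hDdef
  have hψ := hηD.cutoff_mul hn hs hη
  set ψ : V n → ℝ := fun x => η x * (η x * D x) with hψdef
  have hψz : MemH s δ (fun x => ψ (x - z)) := by
    simpa only [sub_eq_add_neg] using hψ.shift (-z)
  have hκabs := hκ.abs_le hlam.le
  have hκzm : Measurable (fun p => κ (p + (z, z))) := hκ.meas.comp (measurable_id.add_const _)
  have hκzabs : ∀ᵐ p, |κ (p + (z, z))| ≤ Lam * sing s δ (p.1 - p.2) := by
    filter_upwards [ae_shift hκabs (z, z)] with p hp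
    simpa using hp
  have hid : form κ D ψ = form κ v (fun x => ψ (x - z) - ψ x) -
      form (fun p => κ (p + (z, z)) - κ p) (fun x => v (x + z)) ψ := by
    rw [form_sub_right hκ.meas hκabs hv hψz hψ, form_shift,
      form_sub_kernel hκzm hκzabs hκ.meas hκabs hvz hψ, hDdef,
      form_sub_left hκ.meas hκabs hvz hv hψ]
    ring
  have hDle : sqn D ≤ T * ρ * gag s δ v := sqn_translate_le hn hs0 hv hz hzδ
  have hφle : sqn (fun x => ψ (x - z) - ψ x) ≤ T * ρ * gag s δ ψ := by
    have := sqn_translate_le hn hs0 hψ (neg_ne_zero.2 hz) (by rwa [norm_neg])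
    rw [norm_neg] at this
    simpa only [sub_eq_add_neg] using this
  have hψle : gag s δ ψ ≤ 2 * gag s δ (fun x => η x * D x) + 2 * L ^ 2 * m * (T * ρ * gag s δ v) := by
    refine (gag_cutoff_mul_le hn hs hη hηD).trans ?_
    gcongr
    exact (hη.sqn_mul_le hD.meas hD.sq).trans hDle
  have hcac := caccioppoli hn hs hlam.le hκ hη hD
  have h1 := heq ψ rfl (τ / ρ) (by positivity)
  have h2 := abs_form_le (t := τ / ‖z‖ ^ s) (hκzm.sub hκ.meas) hhol hvz hψ (by positivity)
  rw [gag_shift] at h2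
  have h2' := (neg_le_abs _).trans h2
  have hfin := sqn_translate_le hn hs0 hηD hz hzδ
  set A := gag s δ (fun x => η x * D x) with hA
  set X := gag s δ ψ with hX
  set g := gag s δ v with hg
  have hg0 : 0 ≤ g := gag_nonneg _ _ _
  have hA0 : 0 ≤ A := gag_nonneg _ _ _
  have h1' : form κ v (fun x => ψ (x - z) - ψ x) ≤ ρ * τ⁻¹ * R + τ * (C₁ * T) * X := by
    refine h1.trans ?_
    have : τ / ρ * C₁ * sqn (fun x => ψ (x - z) - ψ x) ≤ τ / ρ * C₁ * (T * ρ * X) := by gcongr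
    calc _ ≤ (τ / ρ)⁻¹ * R + τ / ρ * C₁ * (T * ρ * X) := by gcongr
      _ = _ := by field_simp
  have h2'' : -form (fun p => κ (p + (z, z)) - κ p) (fun x => v (x + z)) ψ ≤
      G * τ⁻¹ * ρ * g + τ * G * X := by
    refine h2'.trans (le_of_eq ?_)
    rw [← hρs]
    field_simp
  have hsum : lam * A ≤ ρ * τ⁻¹ * R + τ * (C₁ * T + G) * X + G * τ⁻¹ * ρ * g +
      Lam * L ^ 2 * m * (T * ρ * g) := by
    have : Lam * L ^ 2 * m * sqn D ≤ Lam * L ^ 2 * m * (T * ρ * g) := by gcongr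
    rw [hid] at hcac
    linarith
  rw [hτeq] at hsum
  have hX' := mul_le_mul_of_nonneg_left hψle (show 0 ≤ lam / 4 by positivity)
  have hAle : lam / 2 * A ≤ ρ * C₂ * (R + g) := by
    have e : ρ * C₂ * (R + g) = ρ * τ⁻¹ * R + G * τ⁻¹ * ρ * g +
        Lam * L ^ 2 * m * (T * ρ * g) + lam / 2 * (L ^ 2 * m * (T * ρ * g)) +
        (ρ * (G * τ⁻¹ + Lam * L ^ 2 * m * T + lam / 2 * L ^ 2 * m * T) * R + ρ * τ⁻¹ * g) := by
      rw [hC₂]; ring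
    have : 0 ≤ ρ * (G * τ⁻¹ + Lam * L ^ 2 * m * T + lam / 2 * L ^ 2 * m * T) * R + ρ * τ⁻¹ * g := by
      positivity
    rw [e]
    linarith
  have hAle' : A ≤ 2 / lam * (ρ * C₂ * (R + g)) := by
    rw [div_mul_eq_mul_div, le_div_iff₀ hlam]
    linarith
  calc _ ≤ T * ρ * A := hfin
    _ ≤ T * ρ * (2 / lam * (ρ * C₂ * (R + g))) := by gcongr
    _ = _ := by ring

/-! ### The near part of the kernel -/

/-- The part of the kernel `K` near the diagonal, vanishing on the diagonal. -/
def nearK (δ : ℝ) (K : V n → V n → ℝ) (p : V n × V n) : ℝ :=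
  {q : V n × V n | q.1 ≠ q.2 ∧ ‖q.1 - q.2‖ < δ}.indicator (fun q => K q.1 q.2) p

lemma nearK_of_near {δ : ℝ} {K : V n → V n → ℝ} {p : V n × V n} (h : p.1 ≠ p.2)
    (h' : ‖p.1 - p.2‖ < δ) : nearK δ K p = K p.1 p.2 :=
  indicator_of_mem (show p ∈ {q : V n × V n | q.1 ≠ q.2 ∧ ‖q.1 - q.2‖ < δ} from ⟨h, h'⟩) _

lemma nearK_of_far {δ : ℝ} {K : V n → V n → ℝ} {p : V n × V n} (h : δ ≤ ‖p.1 - p.2‖) :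
    nearK δ K p = 0 :=
  indicator_of_notMem (fun hp => hp.2.not_ge h) _

lemma nearK_diag {δ : ℝ} {K : V n → V n → ℝ} {p : V n × V n} (h : p.1 = p.2) :
    nearK δ K p = 0 :=
  indicator_of_notMem (fun hp => hp.1 h) _

lemma measurable_nearK {δ : ℝ} {K : V n → V n → ℝ} (hK : Measurable (Function.uncurry K)) :
    Measurable (nearK δ K) := by
  refine Measurable.indicator hK (MeasurableSet.inter ?_ ?_)
  · exact (measurableSet_eq_fun measurable_fst measurable_snd).compl
  · exact measurableSet_lt (measurable_fst.sub measurable_snd).norm measurable_const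

lemma sing_zero (hn : 1 ≤ n) {s : ℝ} (hs : 0 < s) (δ : ℝ) : sing s δ (0 : V n) = 0 := by
  have h : (1 : ℝ) ≤ n := by exact_mod_cast hn
  unfold sing
  split_ifs
  · rw [norm_zero, Real.zero_rpow (by linarith)]
  · rfl

lemma sing_of_far {s δ : ℝ} {h : V n} (hh : δ ≤ ‖h‖) : sing s δ h = 0 := if_neg hh.not_gt

lemma isNearKernel_nearK (hn : 1 ≤ n) {s β lam Lam M δ : ℝ} (hs : 0 < s) (hδ : δ ≤ 1)
    {K : V n → V n → ℝ} (hKm : Measurable (Function.uncurry K)) (hK : KBounds s β lam Lam M K) :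
    IsNearKernel s δ lam Lam (nearK δ K) := by
  have key : ∀ᵐ p : V n × V n, lam * sing s δ (p.1 - p.2) ≤ nearK δ K p ∧
      nearK δ K p ≤ Lam * sing s δ (p.1 - p.2) := by
    filter_upwards [hK.1] with p hp
    by_cases h : p.1 = p.2
    · simp [nearK_diag h, h, sing_zero hn hs]
    by_cases h' : ‖p.1 - p.2‖ < δ
    · obtain ⟨h1, h2⟩ := hp (h'.trans_le hδ)
      have hpos : 0 < ‖p.1 - p.2‖ := norm_pos_iff.2 (sub_ne_zero.2 h)
      have hpow : 0 < ‖p.1 - p.2‖ ^ ((n : ℝ) + 2 * s) := Real.rpow_pos_of_pos hpos _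
      rw [nearK_of_near h h', sing, if_pos h', Real.rpow_neg hpos.le, ← div_eq_mul_inv,
        ← div_eq_mul_inv, div_le_iff₀ hpow, le_div_iff₀ hpow]
      constructor <;> linarith
    · simp [nearK_of_far (not_lt.1 h'), sing_of_far (not_lt.1 h')]
  exact ⟨measurable_nearK hKm, key.mono fun _ h => h.1, key.mono fun _ h => h.2⟩

/-- The Hölder condition on the kernel, for every fixed translation. -/
lemma KHolder.ae_of_translation {s Gam : ℝ} {K : V n → V n → ℝ} (hs : 0 < s) (hGam : 0 < Gam)
    (hK : KHolder s Gam K) {z : V n} (hz : z ≠ 0) (hz1 : ‖z‖ < 1) :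
    ∀ᵐ p : V n × V n, ‖p.1 - p.2‖ < 1 → ‖p.1 - p.2‖ ^ ((n : ℝ) + 2 * s) *
      |K (p.1 + z) (p.2 + z) - K p.1 p.2| ≤ 2 * Gam * ‖z‖ ^ s := by
  have hz0 : 0 < ‖z‖ := norm_pos_iff.2 hz
  let P : V n → V n × V n → Prop := fun y p => ‖p.1 - p.2‖ < 1 → ‖y‖ < 1 →
    ‖p.1 - p.2‖ ^ ((n : ℝ) + 2 * s) * |K (p.1 + y) (p.2 + y) - K p.1 p.2| ≤ Gam * ‖y‖ ^ s
  have hP : ∀ᵐ y : V n, ∀ᵐ p : V n × V n, P y p := Measure.ae_ae_of_ae_prod hK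
  have hP' : ∀ᵐ y : V n, ∀ᵐ p : V n × V n, P (z - y) p :=
    (Measure.measurePreserving_sub_left (volume : Measure (V n)) z).quasiMeasurePreserving.ae hP
  have hball : ∃ y ∈ ball ((2⁻¹ : ℝ) • z) (‖z‖ / 2),
      (∀ᵐ p : V n × V n, P y p) ∧ ∀ᵐ p : V n × V n, P (z - y) p := by
    by_contra hcon
    have h0 : volume (ball ((2⁻¹ : ℝ) • z) (‖z‖ / 2)) = 0 := by
      refine measure_mono_null (fun y hy => ?_) (ae_iff.1 (hP.and hP'))
      exact fun h => hcon ⟨y, hy, h⟩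
    exact (measure_ball_pos volume _ (half_pos hz0)).ne' h0
  obtain ⟨y, hy, hy1, hy2⟩ := hball
  rw [mem_ball, dist_eq_norm] at hy
  have hc : ‖(2⁻¹ : ℝ) • z‖ = ‖z‖ / 2 := by rw [norm_smul]; norm_num; ring
  have hyz : ‖y‖ ≤ ‖z‖ := by
    calc ‖y‖ = ‖(y - (2⁻¹ : ℝ) • z) + (2⁻¹ : ℝ) • z‖ := by rw [sub_add_cancel]
      _ ≤ _ := norm_add_le _ _
      _ ≤ ‖z‖ := by rw [hc]; linarith
  have hzy : ‖z - y‖ ≤ ‖z‖ := by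
    calc ‖z - y‖ = ‖(2⁻¹ : ℝ) • z - (y - (2⁻¹ : ℝ) • z)‖ := by
          congr 1
          have : z = (2⁻¹ : ℝ) • z + (2⁻¹ : ℝ) • z := by rw [← add_smul]; norm_num
          conv_lhs => rw [this]
          abel
      _ ≤ _ := norm_sub_le _ _
      _ ≤ ‖z‖ := by rw [hc]; linarith
  filter_upwards [hy1, ae_shift hy2 (y, y)] with p h1 h2 hp
  have e1 := h1 hp (hyz.trans_lt hz1)
  have e2 := h2 (by simpa using hp) (hzy.trans_lt hz1)
  simp only [Prod.fst_add, Prod.snd_add, add_sub_add_right_eq_sub, add_assoc,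
    add_sub_cancel] at e2
  have e3 : ‖y‖ ^ s ≤ ‖z‖ ^ s := Real.rpow_le_rpow (norm_nonneg _) hyz hs.le
  have e4 : ‖z - y‖ ^ s ≤ ‖z‖ ^ s := Real.rpow_le_rpow (norm_nonneg _) hzy hs.le
  have e5 : |K (p.1 + z) (p.2 + z) - K p.1 p.2| ≤
      |K (p.1 + z) (p.2 + z) - K (p.1 + y) (p.2 + y)| + |K (p.1 + y) (p.2 + y) - K p.1 p.2| :=
    abs_sub_le _ _ _
  have e6 := mul_le_mul_of_nonneg_left e5
    (show 0 ≤ ‖p.1 - p.2‖ ^ ((n : ℝ) + 2 * s) by positivity)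
  have e7 := mul_le_mul_of_nonneg_left e3 hGam.le
  have e8 := mul_le_mul_of_nonneg_left e4 hGam.le
  linarith

lemma nearK_shift_sub_le (hn : 1 ≤ n) {s δ Gam : ℝ} {K : V n → V n → ℝ} (hs : 0 < s)
    (hδ : δ ≤ 1) (hGam : 0 < Gam) (hK : KHolder s Gam K) {z : V n} (hz : z ≠ 0) (hzδ : ‖z‖ < δ) :
    ∀ᵐ p : V n × V n, |nearK δ K (p + (z, z)) - nearK δ K p| ≤
      2 * Gam * ‖z‖ ^ s * sing s δ (p.1 - p.2) := by
  filter_upwards [hK.ae_of_translation hs hGam hz (hzδ.trans_le hδ)] with p hp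
  by_cases h : p.1 = p.2
  · rw [nearK_diag h, nearK_diag (p := p + (z, z)) (by simpa using h)]
    simp [h, sing_zero hn hs]
  by_cases h' : ‖p.1 - p.2‖ < δ
  · have hpos : 0 < ‖p.1 - p.2‖ := norm_pos_iff.2 (sub_ne_zero.2 h)
    have hpow : 0 < ‖p.1 - p.2‖ ^ ((n : ℝ) + 2 * s) := Real.rpow_pos_of_pos hpos _
    rw [nearK_of_near h h', nearK_of_near (p := p + (z, z)) (by simpa using h) (by simpa using h'),
      sing, if_pos h', Real.rpow_neg hpos.le, ← div_eq_mul_inv, le_div_iff₀ hpow, mul_comm]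
    exact hp (h'.trans_le hδ)
  · have h'' := not_lt.1 h'
    rw [nearK_of_far h'', nearK_of_far (p := p + (z, z)) (by simpa using h''), sing_of_far h'']
    simp

/-! ### The far part of the kernel -/

/-- The decay weight. -/
def decay (β : ℝ) (x : V n) : ℝ := 1 / (1 + ‖x‖ ^ ((n : ℝ) + β))

lemma decay_pos (β : ℝ) (x : V n) : 0 < decay β x := by
  unfold decay; positivity

lemma measurable_decay (β : ℝ) : Measurable (decay β : V n → ℝ) :=
  measurable_const.div (measurable_const.add (measurable_norm.pow_const _))

lemma integrable_decay {β : ℝ} (hβ : 0 < β) : Integrable (decay β : V n → ℝ) := by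
  have hr : (Module.finrank ℝ (V n) : ℝ) < (n : ℝ) + β := by
    rw [finrank_euclideanSpace_fin]; linarith
  refine ((integrable_one_add_norm (μ := (volume : Measure (V n))) hr).const_mul
    (2 ^ ((n : ℝ) + β))).mono' (measurable_decay β).aestronglyMeasurable (.of_forall fun x => ?_)
  rw [Real.norm_of_nonneg (decay_pos β x).le, decay, Real.rpow_neg (by positivity),
    ← div_eq_mul_inv, div_le_div_iff₀ (by positivity) (by positivity), one_mul]
  have hnb : 0 ≤ (n : ℝ) + β := by positivity
  rcases le_total ‖x‖ 1 with h | h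
  · calc (1 + ‖x‖) ^ ((n : ℝ) + β) ≤ 2 ^ ((n : ℝ) + β) :=
          Real.rpow_le_rpow (by positivity) (by linarith) hnb
      _ ≤ _ := le_mul_of_one_le_right (by positivity) (le_add_of_nonneg_right (by positivity))
  · calc (1 + ‖x‖) ^ ((n : ℝ) + β) ≤ (2 * ‖x‖) ^ ((n : ℝ) + β) :=
          Real.rpow_le_rpow (by positivity) (by linarith) hnb
      _ = 2 ^ ((n : ℝ) + β) * ‖x‖ ^ ((n : ℝ) + β) :=
          Real.mul_rpow (by norm_num) (norm_nonneg _)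
      _ ≤ _ := mul_le_mul_of_nonneg_left (by linarith) (by positivity)

lemma exists_far_bound {s β lam Lam M δ : ℝ} (hs : 0 < s) (hβ : 0 < β) (hLam : 0 < Lam)
    (hM : 0 < M) (hδ : 0 < δ) {S : Set (V n)} (hS : Bornology.IsBounded S) :
    ∃ C > 0, ∀ K : V n → V n → ℝ, KBounds s β lam Lam M K →
      ∀ᵐ p : V n × V n, p.1 ∈ S → δ ≤ ‖p.1 - p.2‖ → K p.1 p.2 ≤ C * decay β p.2 := by
  obtain ⟨R, hR0, hR⟩ := hS.exists_pos_norm_le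
  have hnb : 0 ≤ (n : ℝ) + β := by positivity
  refine ⟨M * (1 + (2 + R) ^ ((n : ℝ) + β)) +
    Lam * δ ^ (-((n : ℝ) + 2 * s)) * (1 + (1 + R) ^ ((n : ℝ) + β)), by positivity, ?_⟩
  intro K hK
  filter_upwards [hK.1, hK.2] with p h1 h2 hpS hpδ
  have hpR : ‖p.1‖ ≤ R := hR _ hpS
  have htri : ‖p.2‖ ≤ R + ‖p.1 - p.2‖ := by
    calc ‖p.2‖ = ‖p.1 - (p.1 - p.2)‖ := by rw [sub_sub_cancel]
      _ ≤ ‖p.1‖ + ‖p.1 - p.2‖ := norm_sub_le _ _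
      _ ≤ _ := by linarith
  have hd : 0 < 1 + ‖p.2‖ ^ ((n : ℝ) + β) := by positivity
  have hpos : 0 < ‖p.1 - p.2‖ := hδ.trans_le hpδ
  rw [decay, ← mul_div_assoc, mul_one, le_div_iff₀ hd]
  rcases lt_or_ge ‖p.1 - p.2‖ 1 with h | h
  · have hK1 : K p.1 p.2 ≤ Lam * δ ^ (-((n : ℝ) + 2 * s)) := by
      have hpow : 0 < ‖p.1 - p.2‖ ^ ((n : ℝ) + 2 * s) := Real.rpow_pos_of_pos hpos _
      have e1 : K p.1 p.2 ≤ Lam / ‖p.1 - p.2‖ ^ ((n : ℝ) + 2 * s) := by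
        rw [le_div_iff₀ hpow, mul_comm]; exact (h1 h).2
      refine e1.trans ?_
      rw [Real.rpow_neg hδ.le, ← div_eq_mul_inv]
      have : 0 ≤ (n : ℝ) + 2 * s := by positivity
      gcongr
    have hy : ‖p.2‖ ^ ((n : ℝ) + β) ≤ (1 + R) ^ ((n : ℝ) + β) :=
      Real.rpow_le_rpow (norm_nonneg _) (by linarith) hnb
    calc K p.1 p.2 * (1 + ‖p.2‖ ^ ((n : ℝ) + β)) ≤
        Lam * δ ^ (-((n : ℝ) + 2 * s)) * (1 + ‖p.2‖ ^ ((n : ℝ) + β)) := by gcongr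
      _ ≤ Lam * δ ^ (-((n : ℝ) + 2 * s)) * (1 + (1 + R) ^ ((n : ℝ) + β)) := by gcongr
      _ ≤ _ := le_add_of_nonneg_left (by positivity)
  · have hpow : 1 ≤ ‖p.1 - p.2‖ ^ ((n : ℝ) + β) := Real.one_le_rpow h hnb
    have hy : ‖p.2‖ ^ ((n : ℝ) + β) ≤ (2 + R) ^ ((n : ℝ) + β) * ‖p.1 - p.2‖ ^ ((n : ℝ) + β) := by
      rw [← Real.mul_rpow (by positivity) (norm_nonneg _)]
      exact Real.rpow_le_rpow (norm_nonneg _) (by nlinarith) hnb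
    obtain ⟨h3, h4⟩ := h2 h
    have h5 : 0 ≤ K p.1 p.2 := nonneg_of_mul_nonneg_right h3 (by positivity)
    calc K p.1 p.2 * (1 + ‖p.2‖ ^ ((n : ℝ) + β)) ≤ K p.1 p.2 *
        (‖p.1 - p.2‖ ^ ((n : ℝ) + β) + (2 + R) ^ ((n : ℝ) + β) * ‖p.1 - p.2‖ ^ ((n : ℝ) + β)) := by
          gcongr
      _ = ‖p.1 - p.2‖ ^ ((n : ℝ) + β) * K p.1 p.2 * (1 + (2 + R) ^ ((n : ℝ) + β)) := by ring
      _ ≤ M * (1 + (2 + R) ^ ((n : ℝ) + β)) := by gcongr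
      _ ≤ _ := le_add_of_nonneg_right (by positivity)

lemma ae_swap {P : V n × V n → Prop} (h : ∀ᵐ p, P p) : ∀ᵐ p : V n × V n, P (p.2, p.1) := by
  rw [Measure.volume_eq_prod] at *
  exact Measure.measurePreserving_swap.quasiMeasurePreserving.ae h

/-- Far from the diagonal, a function supported in `S` interacts with `K` through the decay
weight only. -/
lemma far_bounds {δ C β : ℝ} {K : V n → V n → ℝ} (hsym : KSym K) {S : Set (V n)}
    (hfar : ∀ᵐ p : V n × V n, p.1 ∈ S → δ ≤ ‖p.1 - p.2‖ → K p.1 p.2 ≤ C * decay β p.2)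
    {a : V n → ℝ} (ha0 : ∀ x, 0 ≤ a x) (ha : ∀ x ∉ S, a x = 0) :
    ∀ᵐ p : V n × V n, δ ≤ ‖p.1 - p.2‖ → a p.1 * K p.1 p.2 ≤ C * (a p.1 * decay β p.2) ∧
      a p.2 * K p.1 p.2 ≤ C * (a p.2 * decay β p.1) := by
  filter_upwards [hfar, ae_swap hfar, hsym] with p h1 h2 h3 hp
  constructor
  · by_cases hS : p.1 ∈ S
    · have := mul_le_mul_of_nonneg_left (h1 hS hp) (ha0 p.1)
      linarith
    · simp [ha _ hS]
  · by_cases hS : p.2 ∈ S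
    · have := mul_le_mul_of_nonneg_left (h2 hS (by rwa [norm_sub_rev])) (ha0 p.2)
      rw [h3]
      linarith
    · simp [ha _ hS]

lemma measurable_energy_integrand {K : V n → V n → ℝ} (hK : Measurable (Function.uncurry K))
    {w ψ : V n → ℝ} (hw : Measurable w) (hψ : Measurable ψ) :
    Measurable (fun p : V n × V n => (w p.1 - w p.2) * (ψ p.1 - ψ p.2) * K p.1 p.2) :=
  (measurable_diff_mul hw hψ).mul hK

lemma MemH.integrable_energy {s β lam Lam M δ C : ℝ} (hδ : δ ≤ 1)
    (hβ : 0 < β) (hC : 0 < C) (hn : 1 ≤ n) (hs : 0 < s) {K : V n → V n → ℝ}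
    (hKm : Measurable (Function.uncurry K)) (hK0 : ∀ x y, 0 ≤ K x y) (hsym : KSym K)
    (hK : KBounds s β lam Lam M K) (hLam : 0 < Lam) {S : Set (V n)}
    (hfar : ∀ᵐ p : V n × V n, p.1 ∈ S → δ ≤ ‖p.1 - p.2‖ → K p.1 p.2 ≤ C * decay β p.2)
    {φ : V n → ℝ} (hφ : MemH s δ φ) (hφS : ∀ x ∉ S, φ x = 0) :
    Integrable (fun p : V n × V n => (φ p.1 - φ p.2) ^ 2 * K p.1 p.2) := by
  have h1 : Integrable (fun p : V n × V n => φ p.1 ^ 2 * decay β p.2) :=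
    hφ.sq.mul_prod (integrable_decay hβ)
  have h2 : Integrable (fun p : V n × V n => φ p.2 ^ 2 * decay β p.1) := integrable_swap h1
  refine ((hφ.energy.const_mul Lam).add ((h1.add h2).const_mul (2 * C))).mono'
    ((((hφ.meas.comp measurable_fst).sub (hφ.meas.comp measurable_snd)).pow_const 2).mul
      hKm).aestronglyMeasurable ?_
  filter_upwards [(isNearKernel_nearK hn hs hδ hKm hK).upper,
    far_bounds hsym hfar (a := fun x => φ x ^ 2) (fun _ => sq_nonneg _)
      (fun x hx => by simp [hφS x hx])] with p hp1 hp2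
  rw [Real.norm_of_nonneg (mul_nonneg (sq_nonneg _) (hK0 _ _))]
  simp only [Pi.add_apply]
  have hd1 := (decay_pos β p.1).le
  have hd2 := (decay_pos β p.2).le
  have hg := gagInt_nonneg s δ φ p
  by_cases h : p.1 = p.2
  · have : (φ p.1 - φ p.2) ^ 2 * K p.1 p.2 = 0 := by rw [h]; simp
    rw [this]
    positivity
  by_cases h' : ‖p.1 - p.2‖ < δ
  · rw [nearK_of_near h h'] at hp1
    have e := mul_le_mul_of_nonneg_left hp1 (sq_nonneg (φ p.1 - φ p.2))
    have : 0 ≤ 2 * C * (φ p.1 ^ 2 * decay β p.2 + φ p.2 ^ 2 * decay β p.1) := by positivity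
    rw [gagInt]
    linarith
  · obtain ⟨e1, e2⟩ := hp2 (not_lt.1 h')
    have e3 : (φ p.1 - φ p.2) ^ 2 ≤ 2 * φ p.1 ^ 2 + 2 * φ p.2 ^ 2 := by
      nlinarith [sq_nonneg (φ p.1 + φ p.2)]
    have e4 := mul_le_mul_of_nonneg_right e3 (hK0 p.1 p.2)
    have : 0 ≤ Lam * gagInt s δ φ p := by positivity
    linarith

lemma young {a b t : ℝ} (ht : 0 < t) : a * b ≤ t⁻¹ * a ^ 2 + t * b ^ 2 := by
  have h3 : t⁻¹ * (a - t * b) ^ 2 = t⁻¹ * a ^ 2 + t * b ^ 2 - 2 * (a * b) := by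
    field_simp; ring
  have h5 : 0 ≤ t⁻¹ * (a - t * b) ^ 2 := by positivity
  have h6 : 0 ≤ t⁻¹ * a ^ 2 := by positivity
  have h7 : 0 ≤ t * b ^ 2 := by positivity
  linarith

/-- The squared size of the data of the problem. -/
def dataSq (Ω : Set (V n)) (β : ℝ) (u f : V n → ℝ) : ℝ :=
  (∫ x in Ω, f x ^ 2) + (∫ x in Ω, u x ^ 2) + wnorm β 0 u ^ 2

lemma dataSq_nonneg (Ω : Set (V n)) (β : ℝ) (u f : V n → ℝ) : 0 ≤ dataSq Ω β u f :=
  add_nonneg (add_nonneg (integral_nonneg fun _ => sq_nonneg _)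
    (integral_nonneg fun _ => sq_nonneg _)) (sq_nonneg _)

/-- Removing the far interactions from the weak formulation costs only an `L²` bounded term. -/
lemma exists_form_nearK_le (hn : 1 ≤ n) {s β lam Lam M δ : ℝ} (hs : 0 < s) (hβ : 0 < β)
    (hLam : 0 < Lam) (hM : 0 < M) (hδ0 : 0 < δ) (hδ : δ ≤ 1) {Ω S : Set (V n)}
    (hΩ : MeasurableSet Ω) (hS : Bornology.IsBounded S) (hSm : MeasurableSet S) (hSΩ : S ⊆ Ω) :
    ∃ C > 0, ∀ (K : V n → V n → ℝ) (u f : V n → ℝ),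
      Measurable (Function.uncurry K) → (∀ x y, 0 ≤ K x y) → KSym K →
      KBounds s β lam Lam M K → MemX Ω K u → HasFiniteWnorm β 0 u →
      Measurable f → IntegrableOn (fun x => f x ^ 2) Ω → IsSolution Ω K u f →
      ∀ φ : V n → ℝ, MemH s δ φ → (∀ x ∉ S, φ x = 0) → ∀ t > 0,
        form (nearK δ K) u φ ≤ t⁻¹ * (C * dataSq Ω β u f) + t * C * sqn φ := by
  obtain ⟨B, hB, hfar⟩ := exists_far_bound (lam := lam) hs hβ hLam hM hδ0 hS
  set W : ℝ := ∫ x : V n, decay β x with hW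
  have hW0 : 0 ≤ W := integral_nonneg fun x => (decay_pos β x).le
  set vS : ℝ := volume.real S with hvS
  have hvS0 : 0 ≤ vS := measureReal_nonneg
  refine ⟨1 + 2 * B * W + 2 * B * vS + 2 * B, by positivity, ?_⟩
  intro K u f hKm hK0 hsym hK hu hwu hfm hf hsol φ hφ hφS t ht
  have hfarK := hfar K hK
  have hφK := hφ.integrable_energy hδ hβ hB hn hs hKm hK0 hsym hK hLam hfarK hφS
  have hφΩ : ∀ x ∉ Ω, φ x = 0 := fun x hx => hφS x fun h => hx (hSΩ h)
  obtain ⟨hum, hu2, huK⟩ := hu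
  have hX0 : MemX0 Ω K φ :=
    ⟨⟨hφ.meas, hφ.sq.integrableOn, hφK.integrableOn⟩, .of_forall hφΩ⟩
  have hcross : MeasurableSet (crossSet Ω) :=
    (measurable_fst hΩ).union (measurable_snd hΩ)
  set F : V n × V n → ℝ := fun p => (u p.1 - u p.2) * (φ p.1 - φ p.2) * K p.1 p.2 with hF
  have hFm : Measurable F := measurable_energy_integrand hKm hum hφ.meas
  have hFi : Integrable F := by
    refine (((integrable_indicator_iff hcross).2 huK).add hφK).mono' hFm.aestronglyMeasurable
      (.of_forall fun p => ?_)
    simp only [Pi.add_apply, hF, Real.norm_eq_abs]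
    rw [abs_mul, abs_of_nonneg (hK0 p.1 p.2)]
    by_cases hp : p ∈ crossSet Ω
    · rw [indicator_of_mem hp, ← add_mul]
      refine mul_le_mul_of_nonneg_right ?_ (hK0 _ _)
      rw [abs_le]
      constructor <;> nlinarith [sq_nonneg ((u p.1 - u p.2) + (φ p.1 - φ p.2)),
        sq_nonneg ((u p.1 - u p.2) - (φ p.1 - φ p.2)), sq_nonneg (u p.1 - u p.2),
        sq_nonneg (φ p.1 - φ p.2)]
    · rw [indicator_of_notMem hp]
      simp only [crossSet, mem_ofPred_eq, not_or] at hp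
      simp [hφΩ _ hp.1, hφΩ _ hp.2]
  have henergy : ∫ p, F p = ∫ x in Ω, f x * φ x := by
    rw [← hsol φ hX0, energyForm, Measure.volume_eq_prod]
    exact integral_prod F (by rwa [← Measure.volume_eq_prod])
  set N : V n × V n → ℝ := fun p => nearK δ K p * ((u p.1 - u p.2) * (φ p.1 - φ p.2)) with hN
  have hNm : Measurable N := (measurable_nearK hKm).mul (measurable_diff_mul hum hφ.meas)
  have hNcase : ∀ p, (N p = F p ∧ (‖p.1 - p.2‖ < δ)) ∨ (N p = 0 ∧ δ ≤ ‖p.1 - p.2‖) := by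
    intro p
    rcases lt_or_ge ‖p.1 - p.2‖ δ with h | h
    · left
      refine ⟨?_, h⟩
      by_cases h' : p.1 = p.2
      · simp [hN, hF, h']
      · simp only [hN, hF, nearK_of_near h' h]; ring
    · right
      exact ⟨by simp [hN, nearK_of_far h], h⟩
  have hNi : Integrable N := by
    refine hFi.mono hNm.aestronglyMeasurable (.of_forall fun p => ?_)
    rcases hNcase p with h | h
    · rw [h.1]
    · rw [h.1, norm_zero]; exact norm_nonneg _
  -- products of data with the test function
  have hU : Integrable (Ω.indicator fun x => u x ^ 2) := (integrable_indicator_iff hΩ).2 hu2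
  have hUint : ∫ x, Ω.indicator (fun x => u x ^ 2) x = ∫ x in Ω, u x ^ 2 := integral_indicator hΩ
  have hvol : volume S ≠ ⊤ := hS.measure_lt_top.ne
  have h1S : Integrable (S.indicator fun _ => (1 : ℝ)) :=
    (integrable_indicator_iff hSm).2 (integrableOn_const hvol)
  have h1Sint : ∫ x, S.indicator (fun _ => (1 : ℝ)) x = vS := by
    rw [integral_indicator hSm, setIntegral_const, smul_eq_mul, mul_one]
  have huφ_le : ∀ r > 0, ∀ x, |u x| * |φ x| ≤
      r⁻¹ * Ω.indicator (fun x => u x ^ 2) x + r * φ x ^ 2 := by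
    intro r hr x
    by_cases hx : x ∈ Ω
    · rw [indicator_of_mem hx]
      simpa only [sq_abs] using young (a := |u x|) (b := |φ x|) hr
    · simp [hx, hφΩ x hx]
  have hφ_le : ∀ r > 0, ∀ c x, c * |φ x| ≤
      r⁻¹ * (c ^ 2 * S.indicator (fun _ => (1 : ℝ)) x) + r * φ x ^ 2 := by
    intro r hr c x
    by_cases hx : x ∈ S
    · rw [indicator_of_mem hx, mul_one]
      simpa only [sq_abs] using young (a := c) (b := |φ x|) hr
    · simp [hx, hφS x hx]
  have huφi : Integrable (fun x => |u x| * |φ x|) := by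
    refine ((hU.const_mul (1 : ℝ)⁻¹).add (hφ.sq.const_mul 1)).mono'
      ((hum.norm).mul hφ.meas.norm).aestronglyMeasurable (.of_forall fun x => ?_)
    rw [Real.norm_of_nonneg (by positivity)]
    exact huφ_le 1 one_pos x
  have hφi : Integrable (fun x => |φ x|) := by
    refine (((h1S.const_mul ((1 : ℝ) ^ 2)).const_mul (1 : ℝ)⁻¹).add (hφ.sq.const_mul 1)).mono'
      hφ.meas.norm.aestronglyMeasurable (.of_forall fun x => ?_)
    rw [Real.norm_of_nonneg (abs_nonneg _), ← one_mul |φ x|]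
    exact hφ_le 1 one_pos 1 x
  set ωu : V n → ℝ := fun x => |u x| * decay β x with hωu
  have hωu_eq : ωu = fun x => |u x| / (1 + ‖x - 0‖ ^ ((n : ℝ) + β)) := by
    funext x; simp [hωu, decay, div_eq_mul_inv]
  have hωui : Integrable ωu := by rw [hωu_eq]; exact hwu
  have hωuint : ∫ x, ωu x = wnorm β 0 u := by rw [hωu_eq]; rfl
  set H : V n × V n → ℝ := fun p => |u p.1| * |φ p.1| * decay β p.2 + |φ p.1| * ωu p.2 with hH
  have hH1 : Integrable (fun p : V n × V n => |u p.1| * |φ p.1| * decay β p.2) :=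
    huφi.mul_prod (integrable_decay hβ)
  have hH2 : Integrable (fun p : V n × V n => |φ p.1| * ωu p.2) := hφi.mul_prod hωui
  have hHi : Integrable H := hH1.add hH2
  have hHint : ∫ p, H p = (∫ x, |u x| * |φ x|) * W + (∫ x, |φ x|) * wnorm β 0 u := by
    rw [hH, integral_add hH1 hH2, Measure.volume_eq_prod,
      integral_prod_mul (fun x => |u x| * |φ x|) (decay β), integral_prod_mul (fun x => |φ x|) ωu,
      hωuint]
  have hHs : Integrable (fun p : V n × V n => H (p.2, p.1)) := integrable_swap hHi
  have hrem : ∀ᵐ p, N p - F p ≤ B * (H p + H (p.2, p.1)) := by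
    filter_upwards [far_bounds hsym hfarK (a := fun x => |φ x|) (fun _ => abs_nonneg _)
      (fun x hx => by simp [hφS x hx])] with p hp
    have hH0 : ∀ q, 0 ≤ H q := fun q => by
      have := (decay_pos β q.1).le
      have := (decay_pos β q.2).le
      simp only [hH, hωu]; positivity
    rcases hNcase p with h | h
    · rw [h.1, sub_self]
      exact mul_nonneg hB.le (add_nonneg (hH0 _) (hH0 _))
    · obtain ⟨e1, e2⟩ := hp h.2
      rw [h.1, zero_sub]
      have e3 : |F p| ≤ (|u p.1| + |u p.2|) * (|φ p.1| * K p.1 p.2 + |φ p.2| * K p.1 p.2) := by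
        simp only [hF]
        rw [abs_mul, abs_mul, abs_of_nonneg (hK0 p.1 p.2), ← add_mul, ← mul_assoc]
        refine mul_le_mul_of_nonneg_right ?_ (hK0 _ _)
        exact mul_le_mul (abs_sub _ _) (abs_sub _ _) (abs_nonneg _) (by positivity)
      have e4 := mul_le_mul_of_nonneg_left (add_le_add e1 e2)
        (show 0 ≤ |u p.1| + |u p.2| by positivity)
      refine ((neg_le_abs _).trans (e3.trans e4)).trans (le_of_eq ?_)
      simp only [hH, hωu]
      ring
  have hform : form (nearK δ K) u φ ≤ (∫ x in Ω, f x * φ x) +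
      2 * B * ((∫ x, |u x| * |φ x|) * W + (∫ x, |φ x|) * wnorm β 0 u) := by
    have h1 : ∫ p, (N p - F p) ≤ ∫ p, B * (H p + H (p.2, p.1)) :=
      integral_mono_ae (hNi.sub hFi) ((hHi.add hHs).const_mul B) hrem
    rw [integral_sub hNi hFi, integral_const_mul, integral_add hHi hHs, integral_swap, hHint,
      henergy] at h1
    have h2 : form (nearK δ K) u φ = ∫ p, N p := rfl
    rw [h2]
    linarith
  have b1 : ∫ x in Ω, f x * φ x ≤ t⁻¹ * (∫ x in Ω, f x ^ 2) + t * sqn φ := by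
    have hfφ : ∀ x, |f x * φ x| ≤ t⁻¹ * f x ^ 2 + t * φ x ^ 2 := fun x => by
      rw [abs_mul]
      simpa only [sq_abs] using young (a := |f x|) (b := |φ x|) ht
    have hi : IntegrableOn (fun x => t⁻¹ * f x ^ 2 + t * φ x ^ 2) Ω :=
      (hf.const_mul _).add (hφ.sq.integrableOn.const_mul _)
    calc ∫ x in Ω, f x * φ x ≤ ∫ x in Ω, (t⁻¹ * f x ^ 2 + t * φ x ^ 2) := by
          refine integral_mono (hi.mono' (hfm.mul hφ.meas).aestronglyMeasurable
            (.of_forall hfφ)) hi fun x => (le_abs_self _).trans (hfφ x)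
      _ = t⁻¹ * (∫ x in Ω, f x ^ 2) + t * ∫ x in Ω, φ x ^ 2 := by
          rw [integral_add (hf.const_mul _) (hφ.sq.integrableOn.const_mul _), integral_const_mul,
            integral_const_mul]
      _ ≤ _ := by
          gcongr
          exact setIntegral_le_integral hφ.sq (.of_forall fun _ => sq_nonneg _)
  have b2 : ∫ x, |u x| * |φ x| ≤ t⁻¹ * (∫ x in Ω, u x ^ 2) + t * sqn φ := by
    calc _ ≤ _ := integral_mono huφi ((hU.const_mul t⁻¹).add (hφ.sq.const_mul t)) (huφ_le t ht)
      _ = _ := by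
        rw [integral_add' (hU.const_mul _) (hφ.sq.const_mul _), integral_const_mul,
          integral_const_mul, hUint]
        rfl
  have b3 : (∫ x, |φ x|) * wnorm β 0 u ≤ t⁻¹ * (wnorm β 0 u ^ 2 * vS) + t * sqn φ := by
    rw [mul_comm, ← integral_const_mul]
    calc _ ≤ _ := integral_mono (hφi.const_mul _)
          (((h1S.const_mul (wnorm β 0 u ^ 2)).const_mul t⁻¹).add (hφ.sq.const_mul t))
          (hφ_le t ht (wnorm β 0 u))
      _ = _ := by
        rw [integral_add' ((h1S.const_mul _).const_mul _) (hφ.sq.const_mul _), integral_const_mul,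
          integral_const_mul, integral_const_mul, h1Sint]
        rfl
  have c2 := mul_le_mul_of_nonneg_left b2 (show 0 ≤ 2 * B * W by positivity)
  have c3 := mul_le_mul_of_nonneg_left b3 (show 0 ≤ 2 * B by positivity)
  set f2 := ∫ x in Ω, f x ^ 2 with hf2
  set u2 := ∫ x in Ω, u x ^ 2 with hu2'
  have hf20 : 0 ≤ f2 := integral_nonneg fun _ => sq_nonneg _
  have hu20 : 0 ≤ u2 := integral_nonneg fun _ => sq_nonneg _
  have hs0 := sqn_nonneg φ
  set wn := wnorm β 0 u with hwn
  have hdata : dataSq Ω β u f = f2 + u2 + wn ^ 2 := rfl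
  rw [hdata]
  have d1 : f2 + 2 * B * W * u2 + 2 * B * vS * wn ^ 2 ≤
      (1 + 2 * B * W + 2 * B * vS + 2 * B) * (f2 + u2 + wn ^ 2) := by
    have : 0 ≤ (2 * B * W + 2 * B * vS + 2 * B) * f2 + (1 + 2 * B * vS + 2 * B) * u2 +
        (1 + 2 * B * W + 2 * B) * wn ^ 2 := by positivity
    linarith
  have d2 := mul_le_mul_of_nonneg_left d1 (inv_nonneg.2 ht.le)
  have d3 : 0 ≤ t * (2 * B * vS) * sqn φ := by positivity
  linarith

/-! ### Cutoff functions at a given distance from a set -/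

/-- The cutoff equal to `1` at distance at most `r` from `A` and to `0` at distance at least
`r + δ`. -/
def distCutoff (A : Set (V n)) (δ r : ℝ) (x : V n) : ℝ :=
  max 0 (min 1 (1 + δ⁻¹ * (r - infDist x A)))

lemma isCutoff_distCutoff (A : Set (V n)) {δ : ℝ} (hδ : 0 < δ) (r : ℝ) :
    IsCutoff δ⁻¹ (distCutoff A δ r) where
  meas := measurable_const.max (measurable_const.min (measurable_const.add
    ((measurable_const.sub measurable_infDist).const_mul _)))
  nonneg _ := le_max_left _ _
  le_one _ := max_le zero_le_one (min_le_left _ _)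
  lip x y := by
    have h1 : |infDist y A - infDist x A| ≤ ‖x - y‖ := by
      have := (lipschitz_infDist_pt A).dist_le_mul y x
      rwa [NNReal.coe_one, one_mul, Real.dist_eq, dist_comm, dist_eq_norm] at this
    have h2 : |δ⁻¹ * (infDist y A - infDist x A)| ≤ δ⁻¹ * ‖x - y‖ := by
      rw [abs_mul, abs_of_pos (inv_pos.2 hδ)]
      gcongr
    unfold distCutoff
    refine (abs_max_sub_max_le_max _ _ _ _).trans ?_
    refine max_le (by simpa using mul_nonneg (inv_nonneg.2 hδ.le) (norm_nonneg (x - y))) ?_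
    refine (abs_min_sub_min_le_max _ _ _ _).trans ?_
    refine max_le (by simpa using mul_nonneg (inv_nonneg.2 hδ.le) (norm_nonneg (x - y))) ?_
    refine le_of_eq_of_le ?_ h2
    congr 1
    ring

lemma distCutoff_eq_one {A : Set (V n)} {δ r : ℝ} (hδ : 0 < δ) {x : V n} (h : infDist x A ≤ r) :
    distCutoff A δ r x = 1 := by
  have : 0 ≤ δ⁻¹ * (r - infDist x A) := mul_nonneg (inv_nonneg.2 hδ.le) (by linarith)
  rw [distCutoff, min_eq_left (by linarith), max_eq_right zero_le_one]

lemma distCutoff_eq_zero {A : Set (V n)} {δ r : ℝ} (hδ : 0 < δ) {x : V n}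
    (h : r + δ ≤ infDist x A) : distCutoff A δ r x = 0 := by
  have h1 : δ⁻¹ * (r - infDist x A) ≤ δ⁻¹ * (-δ) :=
    mul_le_mul_of_nonneg_left (by linarith) (inv_nonneg.2 hδ.le)
  have h2 : δ⁻¹ * (-δ) = -1 := by field_simp
  exact max_eq_left ((min_le_right _ _).trans (by linarith))

/-! ### Localization -/

lemma memH_cutoff_mul (hn : 1 ≤ n) {s β lam Lam M δ L : ℝ} (hs0 : 0 < s) (hs : s < 1)
    (hlam : 0 < lam) (hδ : δ ≤ 1) {Ω T : Set (V n)} (hΩ : MeasurableSet Ω)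
    {K : V n → V n → ℝ} (hKm : Measurable (Function.uncurry K)) (hK0 : ∀ x y, 0 ≤ K x y)
    (hK : KBounds s β lam Lam M K) {u χ : V n → ℝ} (hu : MemX Ω K u) (hχ : IsCutoff L χ)
    (hχT : ∀ x ∉ T, χ x = 0) (hδ0 : 0 < δ) (hT : ∀ x ∈ T, ∀ y, ‖x - y‖ < δ → y ∈ Ω) :
    MemH s δ (fun x => χ x * u x) ∧ sqn (fun x => χ x * u x) ≤ ∫ x in Ω, u x ^ 2 := by
  obtain ⟨hum, hu2, huK⟩ := hu
  have hTΩ : T ⊆ Ω := fun x hx => hT x hx x (by simpa using hδ0)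
  have hU : Integrable (Ω.indicator fun x => u x ^ 2) := (integrable_indicator_iff hΩ).2 hu2
  have hle : ∀ x, (χ x * u x) ^ 2 ≤ Ω.indicator (fun x => u x ^ 2) x := fun x => by
    by_cases hx : x ∈ Ω
    · rw [indicator_of_mem hx]; exact hχ.mul_sq_le u x
    · simp [hx, hχT x fun h => hx (hTΩ h)]
  have hsq : Integrable (fun x => (χ x * u x) ^ 2) := by
    refine hU.mono' ((hχ.meas.mul hum).pow_const 2).aestronglyMeasurable (.of_forall fun x => ?_)
    rw [Real.norm_of_nonneg (sq_nonneg _)]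
    exact hle x
  have hcross : MeasurableSet (crossSet Ω) :=
    (measurable_fst hΩ).union (measurable_snd hΩ)
  have hE := (integrable_indicator_iff hcross).2 huK
  refine ⟨⟨hχ.meas.mul hum, hsq, ?_⟩, ?_⟩
  · refine ((hE.const_mul (2 * lam⁻¹)).add
      ((integrable_moment hn hs δ hU).const_mul (2 * L ^ 2))).mono'
      (measurable_gagInt (hχ.meas.mul hum) s δ).aestronglyMeasurable ?_
    filter_upwards [(isNearKernel_nearK hn hs0 hδ hKm hK).lower] with p hp
    rw [Real.norm_of_nonneg (gagInt_nonneg _ _ _ _)]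
    simp only [Pi.add_apply]
    have hE0 : 0 ≤ (crossSet Ω).indicator
        (fun p : V n × V n => (u p.1 - u p.2) ^ 2 * K p.1 p.2) p :=
      indicator_nonneg (fun q _ => mul_nonneg (sq_nonneg _) (hK0 _ _)) p
    have hU0 : 0 ≤ Ω.indicator (fun x => u x ^ 2) p.2 :=
      indicator_nonneg (fun q _ => sq_nonneg _) p.2
    have hnn : 0 ≤ 2 * lam⁻¹ * (crossSet Ω).indicator
        (fun p : V n × V n => (u p.1 - u p.2) ^ 2 * K p.1 p.2) p + 2 * L ^ 2 *
        (Ω.indicator (fun x => u x ^ 2) p.2 * (‖p.1 - p.2‖ ^ 2 * sing s δ (p.1 - p.2))) := by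
      have := sing_nonneg s δ (p.1 - p.2)
      positivity
    rcases le_or_gt δ ‖p.1 - p.2‖ with h | h
    · rw [gagInt, sing_of_far h, mul_zero]
      rwa [sing_of_far h] at hnn
    by_cases hd : p.1 = p.2
    · have : gagInt s δ (fun x => χ x * u x) p = 0 := by simp [gagInt, hd]
      rw [this]
      exact hnn
    by_cases hpT : p.1 ∈ T ∨ p.2 ∈ T
    · have hpΩ : p.1 ∈ Ω ∧ p.2 ∈ Ω := by
        rcases hpT with h1 | h1
        · exact ⟨hTΩ h1, hT _ h1 _ h⟩
        · exact ⟨hT _ h1 _ (by rwa [norm_sub_rev]), hTΩ h1⟩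
      rw [indicator_of_mem (show p ∈ crossSet Ω from .inl hpΩ.1), indicator_of_mem hpΩ.2]
      refine (gagInt_mul_le hχ s δ u p).trans (add_le_add ?_ le_rfl)
      rw [nearK_of_near hd h] at hp
      have e1 : χ p.1 ^ 2 * gagInt s δ u p ≤ gagInt s δ u p :=
        mul_le_of_le_one_left (gagInt_nonneg _ _ _ _) (hχ.sq_le_one _)
      have e2 : gagInt s δ u p = lam⁻¹ * ((u p.1 - u p.2) ^ 2 * (lam * sing s δ (p.1 - p.2))) := by
        rw [gagInt]; field_simp
      have e3 : gagInt s δ u p ≤ lam⁻¹ * ((u p.1 - u p.2) ^ 2 * K p.1 p.2) := by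
        rw [e2]; gcongr
      linarith
    · rw [not_or] at hpT
      have : gagInt s δ (fun x => χ x * u x) p = 0 := by
        simp [gagInt, hχT _ hpT.1, hχT _ hpT.2]
      rw [this]
      exact hnn
  · calc sqn (fun x => χ x * u x) ≤ _ := integral_mono hsq hU hle
      _ = _ := integral_indicator hΩ

lemma form_nearK_congr {δ : ℝ} {K : V n → V n → ℝ} {u v φ : V n → ℝ}
    (h : ∀ x, φ x ≠ 0 → ∀ y, ‖x - y‖ < δ → u y = v y) (hδ : 0 < δ) :
    form (nearK δ K) u φ = form (nearK δ K) v φ := by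
  have h0 : ∀ x, φ x ≠ 0 → u x = v x := fun x hx => h x hx x (by simpa using hδ)
  unfold form
  congr 1
  funext p
  rcases le_or_gt δ ‖p.1 - p.2‖ with hp | hp
  · simp [nearK_of_far hp]
  by_cases h1 : φ p.1 = 0
  · by_cases h2 : φ p.2 = 0
    · simp [h1, h2]
    · rw [h0 _ h2, h _ h2 p.1 (by rwa [norm_sub_rev])]
  · rw [h0 _ h1, h _ h1 p.2 hp]

/-- The local second difference estimate for short translations. -/
lemma exists_diff2_bound_of_small (hn : 1 ≤ n) {s β lam Lam M Gam δ : ℝ} (hs0 : 0 < s)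
    (hs : s < 1) (hβ : 0 < β) (hlam : 0 < lam) (hlL : lam ≤ Lam) (hM : 0 < M) (hGam : 0 < Gam)
    (hδ0 : 0 < δ) (hδ : δ ≤ 1) {Ω A : Set (V n)} (hΩ : MeasurableSet Ω)
    (hA : Bornology.IsBounded A) (hAne : A.Nonempty) (hAΩ : ∀ x, infDist x A ≤ 8 * δ → x ∈ Ω) :
    ∃ C > 0, ∀ (K : V n → V n → ℝ) (u f : V n → ℝ),
      Measurable (Function.uncurry K) → (∀ x y, 0 ≤ K x y) → KSym K →
      KBounds s β lam Lam M K → KHolder s Gam K → MemX Ω K u → HasFiniteWnorm β 0 u →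
      Measurable f → IntegrableOn (fun x => f x ^ 2) Ω → IsSolution Ω K u f →
      ∀ U : Set (V n), IsOpen U → U ⊆ A → ∀ z : V n, z ≠ 0 → ‖z‖ < δ →
        ∫ x in shift2 U z, diff2 z u x ^ 2 ≤ C * (‖z‖ ^ (2 * s)) ^ 2 * dataSq Ω β u f := by
  have hLam : 0 < Lam := hlam.trans_le hlL
  set S : Set (V n) := {x | infDist x A ≤ 5 * δ} with hS
  have hSm : MeasurableSet S := measurableSet_le measurable_infDist measurable_const
  have hSb : Bornology.IsBounded S := by
    refine (hA.thickening (δ := 6 * δ)).subset fun x hx => ?_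
    rw [mem_thickening_iff_infDist_lt hAne]
    have : infDist x A ≤ 5 * δ := hx
    linarith
  have hSΩ : S ⊆ Ω := fun x hx => hAΩ x (by
    have : infDist x A ≤ 5 * δ := hx
    linarith)
  have hdist : ∀ x y : V n, infDist y A ≤ infDist x A + ‖x - y‖ := fun x y => by
    have := infDist_le_infDist_add_dist (s := A) (x := y) (y := x)
    rwa [dist_comm, dist_eq_norm] at this
  obtain ⟨C₁, hC₁, hfar⟩ :=
    exists_form_nearK_le (lam := lam) hn hs0 hβ hLam hM hδ0 hδ hΩ hSb hSm hSΩ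
  obtain ⟨C₂, hC₂, hmain⟩ := exists_second_difference_bound hn hs0 hs δ δ⁻¹ hlam hLam.le
    (show 0 < 2 * Gam by positivity) hC₁
  set m := singMoment n s δ with hm
  have hm0 : 0 ≤ m := singMoment_nonneg n s δ
  set C₃ : ℝ := lam⁻¹ * (2 * C₁ + Lam * δ⁻¹ ^ 2 * m) with hC₃
  have hC₃0 : 0 ≤ C₃ := by positivity
  refine ⟨C₂ * (C₁ + C₃), by positivity, ?_⟩
  intro K u f hKm hK0 hsym hK hKH hu hwu hfm hf hsol U hU hUA z hz hzδ
  have hκ := isNearKernel_nearK hn hs0 hδ hKm hK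
  have hsolφ := hfar K u f hKm hK0 hsym hK hu hwu hfm hf hsol
  set D := dataSq Ω β u f with hD
  have hD0 : 0 ≤ D := dataSq_nonneg Ω β u f
  set η := distCutoff A δ δ with hη_def
  set χ₁ := distCutoff A δ (4 * δ) with hχ₁_def
  set χ₂ := distCutoff A δ (6 * δ) with hχ₂_def
  have hη : IsCutoff δ⁻¹ η := isCutoff_distCutoff A hδ0 δ
  have hχ₁ : IsCutoff δ⁻¹ χ₁ := isCutoff_distCutoff A hδ0 _
  have hχ₂ : IsCutoff δ⁻¹ χ₂ := isCutoff_distCutoff A hδ0 _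
  obtain ⟨hw, hwsq⟩ := memH_cutoff_mul (T := {x | infDist x A < 7 * δ}) hn hs0 hs hlam hδ hΩ hKm
    hK0 hK hu hχ₂ (fun x hx => distCutoff_eq_zero hδ0 (by
      have : ¬ infDist x A < 7 * δ := hx
      linarith)) hδ0 (fun x hx y hxy => hAΩ y (by
      have : infDist x A < 7 * δ := hx
      linarith [hdist x y]))
  set w : V n → ℝ := fun x => χ₂ x * u x with hw_def
  have hwD : sqn w ≤ D := hwsq.trans (by
    have h1 : 0 ≤ ∫ x in Ω, f x ^ 2 := integral_nonneg fun _ => sq_nonneg _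
    have h2 := sq_nonneg (wnorm β 0 u)
    rw [hD, dataSq]
    linarith)
  have hwu' : ∀ x, infDist x A ≤ 6 * δ → u x = w x := fun x hx => by
    simp [hw_def, hχ₂_def, distCutoff_eq_one hδ0 hx]
  set v : V n → ℝ := fun x => χ₁ x * w x with hv_def
  have hv : MemH s δ v := hw.cutoff_mul hn hs hχ₁
  have hvu : ∀ x, infDist x A ≤ 4 * δ → u x = v x := fun x hx => by
    simp only [hv_def, hχ₁_def, distCutoff_eq_one hδ0 hx, one_mul]
    exact hwu' x (by linarith)
  have hgag : gag s δ v ≤ C₃ * D := by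
    have h1 := caccioppoli hn hs hlam.le hκ hχ₁ hw
    have hφ : MemH s δ (fun x => χ₁ x * (χ₁ x * w x)) := hv.cutoff_mul hn hs hχ₁
    have hφS : ∀ x ∉ S, χ₁ x * (χ₁ x * w x) = 0 := fun x hx => by
      have : ¬ infDist x A ≤ 5 * δ := hx
      simp [hχ₁_def, distCutoff_eq_zero (A := A) (r := 4 * δ) (x := x) hδ0 (by linarith)]
    have h2 := hsolφ _ hφ hφS 1 one_pos
    have h3 : form (nearK δ K) u (fun x => χ₁ x * (χ₁ x * w x)) =
        form (nearK δ K) w (fun x => χ₁ x * (χ₁ x * w x)) := by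
      refine form_nearK_congr (fun x hx y hxy => hwu' y ?_) hδ0
      have : x ∈ S := by
        by_contra h
        exact hx (hφS x h)
      have : infDist x A ≤ 5 * δ := this
      linarith [hdist x y]
    have h4 : sqn (fun x => χ₁ x * (χ₁ x * w x)) ≤ D :=
      ((hχ₁.sqn_mul_le hv.meas hv.sq).trans (hχ₁.sqn_mul_le hw.meas hw.sq)).trans hwD
    have h5 := mul_le_mul_of_nonneg_left h4 hC₁.le
    have h6 := mul_le_mul_of_nonneg_left hwD (show 0 ≤ Lam * δ⁻¹ ^ 2 * m by positivity)
    rw [h3] at h2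
    have h7 : lam * gag s δ v ≤ (2 * C₁ + Lam * δ⁻¹ ^ 2 * m) * D := by
      rw [inv_one, one_mul, one_mul] at h2
      linarith
    calc gag s δ v = lam⁻¹ * (lam * gag s δ v) := by field_simp
      _ ≤ lam⁻¹ * ((2 * C₁ + Lam * δ⁻¹ ^ 2 * m) * D) := by gcongr
      _ = C₃ * D := by rw [hC₃]; ring
  have hbound := hmain (nearK δ K) η v z (C₁ * D) (by positivity) hz hzδ hκ
    (nearK_shift_sub_le hn hs0 hδ hGam hKH hz hzδ) hη hv (by
      intro ψ hψ t ht
      have hψH : MemH s δ ψ := by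
        rw [hψ]
        exact ((hv.shift z).sub hv |>.cutoff_mul hn hs hη).cutoff_mul hn hs hη
      have hψ0 : ∀ x, 2 * δ ≤ infDist x A → ψ x = 0 := fun x hx => by
        simp [hψ, hη_def, distCutoff_eq_zero (A := A) (r := δ) (x := x) hδ0 (by linarith)]
      have hφH : MemH s δ (fun x => ψ (x - z) - ψ x) := by
        have := (hψH.shift (-z)).sub hψH
        simpa only [← sub_eq_add_neg] using this
      have hφ0 : ∀ x, 3 * δ ≤ infDist x A → ψ (x - z) - ψ x = 0 := fun x hx => by
        have h1 := hdist (x - z) x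
        have h2 : ‖x - z - x‖ = ‖z‖ := by
          rw [show x - z - x = -z by abel, norm_neg]
        rw [hψ0 x (by linarith), hψ0 (x - z) (by linarith), sub_self]
      have h3 : form (nearK δ K) u (fun x => ψ (x - z) - ψ x) =
          form (nearK δ K) v (fun x => ψ (x - z) - ψ x) := by
        refine form_nearK_congr (fun x hx y hxy => hvu y ?_) hδ0
        have : infDist x A < 3 * δ := by
          by_contra h
          exact hx (hφ0 x (not_lt.1 h))
        linarith [hdist x y]
      rw [← h3]
      exact hsolφ _ hφH (fun x hx => hφ0 x (by
        have : ¬ infDist x A ≤ 5 * δ := hx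
        linarith)) t ht)
  set g : V n → ℝ := fun x => η (x + z) * (v (x + z + z) - v (x + z)) - η x * (v (x + z) - v x)
    with hg
  have hgH : MemH s δ g :=
    ((((hv.shift z).sub hv).cutoff_mul hn hs hη).shift z).sub
      (((hv.shift z).sub hv).cutoff_mul hn hs hη)
  have hz2 : ∀ x : V n, x + (2 : ℕ) • z = x + z + z := fun x => by rw [two_smul, add_assoc]
  have hUm : MeasurableSet (shift2 U z) := by
    have h1 : Measurable fun x : V n => x + z := measurable_id.add_const z
    have h2 : Measurable fun x : V n => x + 2 • z := measurable_id.add_const _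
    exact hU.measurableSet.inter ((h1 hU.measurableSet).inter (h2 hU.measurableSet))
  have hd0 : ∀ x ∈ U, infDist x A = 0 := fun x hx => infDist_zero_of_mem (hUA hx)
  have hUv : ∀ x ∈ U, u x = v x := fun x hx => hvu x (by rw [hd0 x hx]; positivity)
  have hUη : ∀ x ∈ U, η x = 1 := fun x hx => distCutoff_eq_one hδ0 (by rw [hd0 x hx]; positivity)
  calc ∫ x in shift2 U z, diff2 z u x ^ 2 = ∫ x in shift2 U z, g x ^ 2 := by
        refine setIntegral_congr_fun hUm fun x hx => ?_
        obtain ⟨hx0, hx1, hx2⟩ := hx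
        simp only [diff2, hg]
        rw [hUη _ hx0, hUη _ hx1, ← hz2, hUv _ hx0, hUv _ hx1, hUv _ hx2]
        ring
    _ ≤ sqn g := setIntegral_le_integral hgH.sq (.of_forall fun _ => sq_nonneg _)
    _ ≤ C₂ * (‖z‖ ^ (2 * s)) ^ 2 * (C₁ * D + gag s δ v) := hbound
    _ ≤ C₂ * (‖z‖ ^ (2 * s)) ^ 2 * (C₁ * D + C₃ * D) := by gcongr
    _ = C₂ * (C₁ + C₃) * (‖z‖ ^ (2 * s)) ^ 2 * D := by ring

lemma setIntegral_diff2_sq_le {Ω U : Set (V n)} (hΩ : MeasurableSet Ω) (hU : IsOpen U)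
    (hUΩ : U ⊆ Ω) {u : V n → ℝ} (hum : Measurable u) (hu : IntegrableOn (fun x => u x ^ 2) Ω)
    (z : V n) : ∫ x in shift2 U z, diff2 z u x ^ 2 ≤ 18 * ∫ x in Ω, u x ^ 2 := by
  set a : V n → ℝ := Ω.indicator fun x => u x ^ 2 with ha
  have hai : Integrable a := (integrable_indicator_iff hΩ).2 hu
  have haint : ∫ x, a x = ∫ x in Ω, u x ^ 2 := integral_indicator hΩ
  have ha0 : ∀ x, 0 ≤ a x := fun x => indicator_nonneg (fun _ _ => sq_nonneg _) x
  have h1 : Measurable fun x : V n => x + z := measurable_id.add_const z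
  have h2 : Measurable fun x : V n => x + 2 • z := measurable_id.add_const _
  have hUm : MeasurableSet (shift2 U z) :=
    hU.measurableSet.inter ((h1 hU.measurableSet).inter (h2 hU.measurableSet))
  set b : V n → ℝ := fun x => 3 * (a (x + 2 • z) + 4 * a (x + z) + a x) with hb
  have i1 := hai.comp_add_right (2 • z)
  have i2 := (hai.comp_add_right z).const_mul 4
  have i3 : Integrable fun x => a (x + 2 • z) + 4 * a (x + z) := i1.add i2
  have hbi : Integrable b := (i3.add hai).const_mul 3
  have hb0 : ∀ x, 0 ≤ b x := fun x => by
    have := ha0 x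
    have := ha0 (x + z)
    have := ha0 (x + 2 • z)
    simp only [hb]
    positivity
  have hle : ∀ x ∈ shift2 U z, diff2 z u x ^ 2 ≤ b x := fun x hx => by
    obtain ⟨hx0, hx1, hx2⟩ := hx
    simp only [hb, ha]
    rw [indicator_of_mem (hUΩ hx0), indicator_of_mem (hUΩ hx1), indicator_of_mem (hUΩ hx2), diff2]
    nlinarith [sq_nonneg (u (x + 2 • z) + 2 * u (x + z)), sq_nonneg (u (x + 2 • z) - u x),
      sq_nonneg (2 * u (x + z) + u x)]
  have hdm : Measurable (diff2 z u) := ((hum.comp h2).sub ((hum.comp h1).const_mul 2)).add hum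
  have hdi : IntegrableOn (fun x => diff2 z u x ^ 2) (shift2 U z) := by
    refine hbi.integrableOn.mono' (hdm.pow_const 2).aestronglyMeasurable
      (ae_restrict_of_forall_mem hUm fun x hx => ?_)
    rw [Real.norm_of_nonneg (sq_nonneg _)]
    exact hle x hx
  calc ∫ x in shift2 U z, diff2 z u x ^ 2 ≤ ∫ x in shift2 U z, b x :=
        setIntegral_mono_on hdi hbi.integrableOn hUm hle
    _ ≤ ∫ x, b x := setIntegral_le_integral hbi (.of_forall hb0)
    _ = 18 * ∫ x in Ω, u x ^ 2 := by
        simp only [hb]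
        rw [integral_const_mul, integral_add i3 hai, integral_add i1 i2,
          integral_const_mul, integral_add_right_eq_self a, integral_add_right_eq_self a, haint]
        ring

lemma L2norm_sq (A : Set (V n)) (u : V n → ℝ) : L2norm A u ^ 2 = ∫ x in A, u x ^ 2 := by
  rw [L2norm, ← Real.sqrt_eq_rpow, Real.sq_sqrt (integral_nonneg fun _ => sq_nonneg _)]

lemma L2norm_nonneg (A : Set (V n)) (u : V n → ℝ) : 0 ≤ L2norm A u :=
  Real.rpow_nonneg (integral_nonneg fun _ => sq_nonneg _) _

lemma wnorm_nonneg (β : ℝ) (x : V n) (u : V n → ℝ) : 0 ≤ wnorm β x u :=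
  integral_nonneg fun _ => by positivity

lemma dataSq_le (Ω : Set (V n)) (β : ℝ) (u f : V n → ℝ) :
    dataSq Ω β u f ≤ (L2norm Ω u + wnorm β 0 u + L2norm Ω f) ^ 2 := by
  rw [dataSq, ← L2norm_sq, ← L2norm_sq]
  have h1 := L2norm_nonneg Ω u
  have h2 := L2norm_nonneg Ω f
  have h3 := wnorm_nonneg β 0 u
  nlinarith [mul_nonneg h1 h2, mul_nonneg h1 h3, mul_nonneg h2 h3]

/-- **Theorem (intermediate gain of regularity, `s > 1/2`).** A weak solution belongs to
`N^{1/2+s,2}_loc(Ω)`, with the corresponding estimate. -/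
theorem intermediate_nikolskii_regularity {n : ℕ} (hn : 1 ≤ n)
    (s β lam Lam M Gam : ℝ) (hs : s ∈ Ioo (1 / 2 : ℝ) 1) (hβ : 0 < β)
    (hlam : 0 < lam) (hlL : lam ≤ Lam) (hM : 0 < M) (hGam : 0 < Gam)
    (Ω : Set (V n)) (hΩ : IsOpen Ω)
    (Ω' : Set (V n)) (hΩ' : IsOpen Ω') (hΩ'c : IsCompact (closure Ω'))
    (hΩ'Ω : closure Ω' ⊆ Ω) :
    ∃ C > 0, ∀ (K : V n → V n → ℝ) (u f : V n → ℝ),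
      Measurable (Function.uncurry K) → (∀ x y, 0 ≤ K x y) →
      KSym K → KBounds s β lam Lam M K → KHolder s Gam K →
      MemX Ω K u → HasFiniteWnorm β 0 u →
      Measurable f → IntegrableOn (fun x => f x ^ 2) Ω →
      IsSolution Ω K u f →
      ∀ z : V n, z ≠ 0 →
        ‖z‖ ^ (-(1 / 2 + s)) * L2norm (shift2 Ω' z) (diff2 z u) ≤
          C * (L2norm Ω u + wnorm β 0 u + L2norm Ω f) := by
  obtain ⟨hs2, hs1⟩ := hs
  have hs0 : 0 < s := by linarith
  rcases Ω'.eq_empty_or_nonempty with rfl | hne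
  · refine ⟨1, one_pos, fun K u f _ _ _ _ _ _ _ _ _ _ z _ => ?_⟩
    have h1 := L2norm_nonneg Ω u
    have h2 := L2norm_nonneg Ω f
    have h3 := wnorm_nonneg β 0 u
    have h4 : L2norm (shift2 ∅ z) (diff2 z u) = 0 := by simp [L2norm, shift2]
    rw [h4, mul_zero]
    positivity
  set A := closure Ω' with hA
  have hAne : A.Nonempty := hne.mono subset_closure
  obtain ⟨ε, hε, hεΩ⟩ := hΩ'c.exists_cthickening_subset_open hΩ hΩ'Ω
  set δ := min 1 (ε / 9) with hδ_def
  have hδ0 : 0 < δ := lt_min one_pos (by positivity)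
  have hδ1 : δ ≤ 1 := min_le_left _ _
  have hδε : δ ≤ ε / 9 := min_le_right _ _
  have hAΩ : ∀ x, infDist x A ≤ 8 * δ → x ∈ Ω := fun x hx =>
    hεΩ (thickening_subset_cthickening _ _
      ((mem_thickening_iff_infDist_lt hAne).2 (by linarith)))
  obtain ⟨C, hC, hsmall⟩ := exists_diff2_bound_of_small hn hs0 hs1 hβ hlam hlL hM hGam hδ0 hδ1
    hΩ.measurableSet hΩ'c.isBounded hAne hAΩ
  set p : ℝ := 1 / 2 + s with hp
  have hp0 : 0 < p := by linarith
  set B : ℝ := C + 18 * (δ ^ (-p)) ^ 2 with hB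
  refine ⟨√B, Real.sqrt_pos.2 (by positivity), ?_⟩
  intro K u f hKm hK0 hsym hK hKH hu hwu hfm hf hsol z hz
  have hz0 : 0 < ‖z‖ := norm_pos_iff.2 hz
  have hD0 := dataSq_nonneg Ω β u f
  have hX : 0 ≤ L2norm Ω u + wnorm β 0 u + L2norm Ω f :=
    add_nonneg (add_nonneg (L2norm_nonneg Ω u) (wnorm_nonneg β 0 u)) (L2norm_nonneg Ω f)
  refine le_of_sq_le_sq ?_ (mul_nonneg (Real.sqrt_nonneg _) hX)
  rw [mul_pow, mul_pow, L2norm_sq, Real.sq_sqrt (by positivity)]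
  refine le_trans ?_ (mul_le_mul_of_nonneg_left (dataSq_le Ω β u f) (by positivity))
  rcases lt_or_ge ‖z‖ δ with hzδ | hzδ
  · have h1 := hsmall K u f hKm hK0 hsym hK hKH hu hwu hfm hf hsol Ω' hΩ' subset_closure z hz hzδ
    have h2 : ‖z‖ ^ (-p) * ‖z‖ ^ (2 * s) ≤ 1 := by
      rw [← Real.rpow_add hz0]
      exact Real.rpow_le_one hz0.le (hzδ.le.trans hδ1) (by linarith)
    calc (‖z‖ ^ (-p)) ^ 2 * ∫ x in shift2 Ω' z, diff2 z u x ^ 2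
        ≤ (‖z‖ ^ (-p)) ^ 2 * (C * (‖z‖ ^ (2 * s)) ^ 2 * dataSq Ω β u f) := by gcongr
      _ = C * (‖z‖ ^ (-p) * ‖z‖ ^ (2 * s)) ^ 2 * dataSq Ω β u f := by ring
      _ ≤ C * 1 * dataSq Ω β u f := by
          gcongr
          exact pow_le_one₀ (by positivity) h2
      _ ≤ B * dataSq Ω β u f := by
          gcongr
          rw [hB, mul_one]
          exact le_add_of_nonneg_right (by positivity)
  · have h1 := setIntegral_diff2_sq_le hΩ.measurableSet hΩ' (subset_closure.trans hΩ'Ω) hu.1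
      hu.2.1 z
    have h2 : ‖z‖ ^ (-p) ≤ δ ^ (-p) :=
      Real.rpow_le_rpow_of_nonpos hδ0 hzδ (by linarith)
    have h3 : ∫ x in Ω, u x ^ 2 ≤ dataSq Ω β u f := by
      have h4 : 0 ≤ ∫ x in Ω, f x ^ 2 := integral_nonneg fun _ => sq_nonneg _
      have h5 := sq_nonneg (wnorm β 0 u)
      rw [dataSq]
      linarith
    calc (‖z‖ ^ (-p)) ^ 2 * ∫ x in shift2 Ω' z, diff2 z u x ^ 2
        ≤ (δ ^ (-p)) ^ 2 * (18 * ∫ x in Ω, u x ^ 2) := by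
          gcongr
      _ ≤ (δ ^ (-p)) ^ 2 * (18 * dataSq Ω β u f) := by gcongr
      _ = 18 * (δ ^ (-p)) ^ 2 * dataSq Ω β u f := by ring
      _ ≤ B * dataSq Ω β u f := by
          gcongr
          exact le_add_of_nonneg_left hC.le
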